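/- arXiv:0910.1036 — 4 statements merged into one kernel-verified Lean document; each statement's English description precedes it below -/
import Mathlib

section
/- Define φ : Q¹_𝔹 → Q²_ℂ as follows: for [ξ] with ξ = u + v·i₂ (u, v ∈ ℂ³), set φ([ξ]) := [u² + v², 2(u×v)₁, 2(u×v)₂, 2(u×v)₃] ∈ ℙ³(ℂ) if 𝒩(ξ) = u² + v² ≠ 0, and φ([ξ]) := [0, w₁, w₂, w₃] if 𝒩(ξ) = 0, where w ∈ ℂ³ ∖ {0} is a complex representative of ξ (i.e. ξ = λ·w with w² = 0 and λ ∈ 𝔹, 𝒩(λ) ≠ 0). Then φ is well-defined (independent of all choices, with values in Q²_ℂ) and is a bijection from the bicomplex quadric Q¹_𝔹 onto the complex quadric Q²_ℂ. -/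
noncomputable section

/-- Bicomplex multiplication on `𝔹 = ℂ × ℂ`. -/
def bmul (q w : ℂ × ℂ) : ℂ × ℂ := (q.1 * w.1 - q.2 * w.2, q.1 * w.2 + q.2 * w.1)

/-- Complex (square) norm of a bicomplex number. -/
def bN (q : ℂ × ℂ) : ℂ := q.1 ^ 2 + q.2 ^ 2

/-- The first complex part `u` of a bicomplex vector `ξ = u + v i₂ ∈ 𝔹³`. -/
def uPart (ξ : Fin 3 → ℂ × ℂ) : Fin 3 → ℂ := fun k => (ξ k).1

/-- The second complex part `v` of a bicomplex vector `ξ = u + v i₂ ∈ 𝔹³`. -/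
def vPart (ξ : Fin 3 → ℂ × ℂ) : Fin 3 → ℂ := fun k => (ξ k).2

/-- `CQ¹_𝔹`: null bicomplex vectors in `𝔹³` avoiding the fattened origin. -/
def CQset : Set (Fin 3 → ℂ × ℂ) :=
  {ξ | (¬ ∀ k, bN (ξ k) = 0) ∧ ∑ k, bmul (ξ k) (ξ k) = 0}

/-- The relation `ξ ∼ ξ'` iff `ξ' = λ·ξ` for some `λ ∈ 𝔹`. -/
def brel (ξ ξ' : CQset) : Prop :=
  ∃ lam : ℂ × ℂ, ∀ k, (ξ' : Fin 3 → ℂ × ℂ) k = bmul lam ((ξ : Fin 3 → ℂ × ℂ) k)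

/-- The bicomplex quadric `Q¹_𝔹`. -/
def Q1B := Quot brel

/-- Homogeneous representatives of the complex quadric `Q²_ℂ ⊆ ℙ³(ℂ)`. -/
def Q2Cset : Set (Fin 4 → ℂ) :=
  {ζ | ζ ≠ 0 ∧ ζ 0 ^ 2 = ζ 1 ^ 2 + ζ 2 ^ 2 + ζ 3 ^ 2}

/-- Projective equivalence on `Q2Cset`. -/
def q2rel (ζ ζ' : Q2Cset) : Prop :=
  ∃ c : ℂ, c ≠ 0 ∧ (ζ' : Fin 4 → ℂ) = c • (ζ : Fin 4 → ℂ)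

/-- The complex quadric `Q²_ℂ`. -/
def Q2C := Quot q2rel

open Complex Matrix

/-- The first idempotent component `u - i v` of a bicomplex vector `ξ = u + v i₂`. -/
def idemA (ξ : Fin 3 → ℂ × ℂ) : Fin 3 → ℂ := fun k => (ξ k).1 - I * (ξ k).2

/-- The second idempotent component `u + i v` of a bicomplex vector `ξ = u + v i₂`. -/
def idemB (ξ : Fin 3 → ℂ × ℂ) : Fin 3 → ℂ := fun k => (ξ k).1 + I * (ξ k).2

theorem sum_bN_eq (ξ : Fin 3 → ℂ × ℂ) : ∑ k, bN (ξ k) = idemA ξ ⬝ᵥ idemB ξ := by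
  simp only [Fin.sum_univ_three, dotProduct, bN, idemA, idemB]
  linear_combination ((ξ 0).2 ^ 2 + (ξ 1).2 ^ 2 + (ξ 2).2 ^ 2) * I_sq

theorem two_mul_cross_eq (ξ : Fin 3 → ℂ × ℂ) (k : Fin 3) :
    2 * crossProduct (uPart ξ) (vPart ξ) k = -I * crossProduct (idemA ξ) (idemB ξ) k := by
  fin_cases k <;> simp [cross_apply, uPart, vPart, idemA, idemB] <;> ring_nf <;> simp <;> ring

/-- The homogeneous coordinate vector `(𝒩(ξ), 2 (u × v))`. -/
def phiVec (ξ : Fin 3 → ℂ × ℂ) : Fin 4 → ℂ :=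
  ![∑ k, bN (ξ k), 2 * crossProduct (uPart ξ) (vPart ξ) 0,
    2 * crossProduct (uPart ξ) (vPart ξ) 1, 2 * crossProduct (uPart ξ) (vPart ξ) 2]

theorem sum_bmul_self_eq_zero_iff (ξ : Fin 3 → ℂ × ℂ) :
    ∑ k, bmul (ξ k) (ξ k) = 0 ↔ idemA ξ ⬝ᵥ idemA ξ = 0 ∧ idemB ξ ⬝ᵥ idemB ξ = 0 := by
  simp only [Fin.sum_univ_three, dotProduct, bmul, idemA, idemB, Prod.ext_iff, Prod.fst_add,
    Prod.snd_add, Prod.fst_zero, Prod.snd_zero]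
  constructor
  · rintro ⟨h1, h2⟩
    constructor
    · linear_combination h1 - I * h2 + ((ξ 0).2 ^ 2 + (ξ 1).2 ^ 2 + (ξ 2).2 ^ 2) * I_sq
    · linear_combination h1 + I * h2 + ((ξ 0).2 ^ 2 + (ξ 1).2 ^ 2 + (ξ 2).2 ^ 2) * I_sq
  · rintro ⟨h1, h2⟩
    constructor
    · linear_combination (h1 + h2) / 2 - ((ξ 0).2 ^ 2 + (ξ 1).2 ^ 2 + (ξ 2).2 ^ 2) * I_sq
    · linear_combination I * (h1 - h2) / 2 +
        2 * ((ξ 0).1 * (ξ 0).2 + (ξ 1).1 * (ξ 1).2 + (ξ 2).1 * (ξ 2).2) * I_sq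

theorem bN_eq (ξ : Fin 3 → ℂ × ℂ) (k : Fin 3) : bN (ξ k) = idemA ξ k * idemB ξ k := by
  simp only [bN, idemA, idemB]
  linear_combination (ξ k).2 ^ 2 * I_sq

theorem idemA_ne_zero {ξ : Fin 3 → ℂ × ℂ} (h : ξ ∈ CQset) : idemA ξ ≠ 0 := fun h0 =>
  h.1 fun k => by simp [bN_eq, h0]

theorem idemB_ne_zero {ξ : Fin 3 → ℂ × ℂ} (h : ξ ∈ CQset) : idemB ξ ≠ 0 := fun h0 =>
  h.1 fun k => by simp [bN_eq, h0]

theorem idemA_null {ξ : Fin 3 → ℂ × ℂ} (h : ξ ∈ CQset) : idemA ξ ⬝ᵥ idemA ξ = 0 :=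
  ((sum_bmul_self_eq_zero_iff ξ).1 h.2).1

theorem idemB_null {ξ : Fin 3 → ℂ × ℂ} (h : ξ ∈ CQset) : idemB ξ ⬝ᵥ idemB ξ = 0 :=
  ((sum_bmul_self_eq_zero_iff ξ).1 h.2).2

theorem exists_smul_of_cross_eq_zero {x y : Fin 3 → ℂ} (hx : x ≠ 0)
    (h : crossProduct x y = 0) : ∃ c : ℂ, y = c • x := by
  obtain ⟨k, hk⟩ := Function.ne_iff.1 hx
  have h0 := congrFun h 0
  have h1 := congrFun h 1
  have h2 := congrFun h 2
  simp only [cross_apply, Matrix.cons_val, Pi.zero_apply] at h0 h1 h2 hk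
  refine ⟨y k / x k, ?_⟩
  ext j
  simp only [Pi.smul_apply, smul_eq_mul]
  rw [div_mul_eq_mul_div, eq_div_iff hk]
  fin_cases k <;> fin_cases j <;> dsimp <;>
    first
    | ring1
    | linear_combination h0
    | linear_combination h1
    | linear_combination h2
    | linear_combination -h0
    | linear_combination -h1
    | linear_combination -h2

theorem exists_smul_of_null {a b : Fin 3 → ℂ} (ha : a ≠ 0) (hb : b ≠ 0) (haa : a ⬝ᵥ a = 0)
    (hbb : b ⬝ᵥ b = 0) (hab : a ⬝ᵥ b = 0) : ∃ c : ℂ, c ≠ 0 ∧ b = c • a := by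
  have hd : crossProduct a b = 0 := by
    by_contra hd
    have h1 : crossProduct (crossProduct a b) a = 0 := by
      rw [cross_cross_eq_smul_sub_smul]
      simp [haa, hab, dotProduct_comm b a]
    have h2 : crossProduct (crossProduct a b) b = 0 := by
      rw [cross_cross_eq_smul_sub_smul]
      simp [hbb, hab]
    obtain ⟨s, hs⟩ := exists_smul_of_cross_eq_zero hd h1
    obtain ⟨t, ht⟩ := exists_smul_of_cross_eq_zero hd h2
    apply hd
    generalize hdef : crossProduct a b = d at hs ht
    rw [← hdef, hs, ht]
    simp
  obtain ⟨c, hc⟩ := exists_smul_of_cross_eq_zero ha hd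
  refine ⟨c, ?_, hc⟩
  rintro rfl
  exact hb (by simpa using hc)

theorem phiVec_mem {ξ : Fin 3 → ℂ × ℂ} (h : ξ ∈ CQset) (hN : ∑ k, bN (ξ k) ≠ 0) :
    phiVec ξ ∈ Q2Cset := by
  refine ⟨fun h0 => hN (congrFun h0 0), ?_⟩
  simp only [phiVec, two_mul_cross_eq, sum_bN_eq, Matrix.cons_val]
  have h1 := idemA_null h
  have h2 := idemB_null h
  generalize idemA ξ = a at *
  generalize idemB ξ = b at *
  simp only [dotProduct, Fin.sum_univ_three, cross_apply, Matrix.cons_val] at *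
  linear_combination (b 0 * b 0 + b 1 * b 1 + b 2 * b 2) * h1 -
    ((a 1 * b 2 - a 2 * b 1) ^ 2 + (a 2 * b 0 - a 0 * b 2) ^ 2 + (a 0 * b 1 - a 1 * b 0) ^ 2) * I_sq

/-- The point at infinity `(0, w)` determined by a vector `w`. -/
def infVec (w : Fin 3 → ℂ) : Fin 4 → ℂ := ![0, w 0, w 1, w 2]

theorem infVec_mem {w : Fin 3 → ℂ} (hw : w ≠ 0) (h : w ⬝ᵥ w = 0) : infVec w ∈ Q2Cset := by
  constructor
  · intro h0
    apply hw
    ext k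
    have h1 := congrFun h0 k.succ
    fin_cases k <;> exact h1
  · simp only [infVec, Matrix.cons_val]
    simp only [dotProduct, Fin.sum_univ_three] at h
    linear_combination -h

theorem infVec_smul (c : ℂ) (w : Fin 3 → ℂ) : infVec (c • w) = c • infVec w := by
  simp [infVec]

open Classical in
/-- The map `φ` on representatives. -/
def phiRep (ξ : CQset) : Quot q2rel :=
  if hN : ∑ k, bN (ξ.1 k) ≠ 0 then Quot.mk q2rel ⟨phiVec ξ.1, phiVec_mem ξ.2 hN⟩
  else Quot.mk q2rel ⟨infVec (idemA ξ.1), infVec_mem (idemA_ne_zero ξ.2) (idemA_null ξ.2)⟩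

theorem phiRep_of_ne {ξ : CQset} (hN : ∑ k, bN (ξ.1 k) ≠ 0) :
    phiRep ξ = Quot.mk q2rel ⟨phiVec ξ.1, phiVec_mem ξ.2 hN⟩ := dif_pos hN

theorem phiRep_of_eq {ξ : CQset} (hN : ∑ k, bN (ξ.1 k) = 0) :
    phiRep ξ = Quot.mk q2rel ⟨infVec (idemA ξ.1),
      infVec_mem (idemA_ne_zero ξ.2) (idemA_null ξ.2)⟩ := dif_neg (not_not.2 hN)

theorem phiVec_eq (ξ : Fin 3 → ℂ × ℂ) :
    phiVec ξ = ![idemA ξ ⬝ᵥ idemB ξ, -I * crossProduct (idemA ξ) (idemB ξ) 0,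
      -I * crossProduct (idemA ξ) (idemB ξ) 1, -I * crossProduct (idemA ξ) (idemB ξ) 2] := by
  simp only [phiVec, two_mul_cross_eq, sum_bN_eq]

theorem idemA_bmul {ξ ξ' : Fin 3 → ℂ × ℂ} {l : ℂ × ℂ} (h : ∀ k, ξ' k = bmul l (ξ k)) :
    idemA ξ' = (l.1 - I * l.2) • idemA ξ := by
  ext k
  simp only [idemA, h, bmul, Pi.smul_apply, smul_eq_mul]
  linear_combination -l.2 * (ξ k).2 * I_sq

theorem idemB_bmul {ξ ξ' : Fin 3 → ℂ × ℂ} {l : ℂ × ℂ} (h : ∀ k, ξ' k = bmul l (ξ k)) :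
    idemB ξ' = (l.1 + I * l.2) • idemB ξ := by
  ext k
  simp only [idemB, h, bmul, Pi.smul_apply, smul_eq_mul]
  linear_combination -l.2 * (ξ k).2 * I_sq

theorem brel_of_idem {ξ ξ' : CQset} {α β : ℂ} (hA : idemA ξ'.1 = α • idemA ξ.1)
    (hB : idemB ξ'.1 = β • idemB ξ.1) : brel ξ ξ' := by
  refine ⟨((α + β) / 2, I * (α - β) / 2), fun k => ?_⟩
  have h1 := congrFun hA k
  have h2 := congrFun hB k
  simp only [idemA, idemB, Pi.smul_apply, smul_eq_mul] at h1 h2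
  ext <;> simp only [bmul]
  · linear_combination (h1 + h2) / 2
  · linear_combination I * (h1 - h2) / 2 + (((ξ'.1 k).2) - (α + β) / 2 * (ξ.1 k).2) * I_sq

theorem phiRep_congr (ξ ξ' : CQset) (h : brel ξ ξ') : phiRep ξ = phiRep ξ' := by
  obtain ⟨l, hl⟩ := h
  have hA := idemA_bmul hl
  have hB := idemB_bmul hl
  have hα : l.1 - I * l.2 ≠ 0 := fun h0 => idemA_ne_zero ξ'.2 (by rw [hA, h0, zero_smul])
  have hβ : l.1 + I * l.2 ≠ 0 := fun h0 => idemB_ne_zero ξ'.2 (by rw [hB, h0, zero_smul])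
  generalize l.1 - I * l.2 = α at *
  generalize l.1 + I * l.2 = β at *
  have hN : ∑ k, bN (ξ'.1 k) = α * β * ∑ k, bN (ξ.1 k) := by
    simp only [sum_bN_eq, hA, hB, smul_dotProduct, dotProduct_smul, smul_eq_mul]
    ring
  by_cases h0 : ∑ k, bN (ξ.1 k) = 0
  · rw [phiRep_of_eq h0, phiRep_of_eq (by rw [hN, h0, mul_zero])]
    refine Quot.sound ⟨α, hα, ?_⟩
    simp only [hA, infVec_smul]
  · rw [phiRep_of_ne h0, phiRep_of_ne (by rw [hN]; exact mul_ne_zero (mul_ne_zero hα hβ) h0)]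
    refine Quot.sound ⟨α * β, mul_ne_zero hα hβ, ?_⟩
    simp only [phiVec_eq, hA, hB]
    ext k
    fin_cases k <;> simp [mul_assoc, mul_left_comm]

theorem q2rel_of_mk_eq {ζ ζ' : Q2Cset} (h : Quot.mk q2rel ζ = Quot.mk q2rel ζ') :
    q2rel ζ ζ' := by
  have he : Equivalence q2rel :=
    { refl := fun x => ⟨1, one_ne_zero, by simp⟩
      symm := by
        rintro x y ⟨c, hc, h⟩
        exact ⟨c⁻¹, inv_ne_zero hc, by rw [h, smul_smul, inv_mul_cancel₀ hc, one_smul]⟩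
      trans := by
        rintro x y z ⟨c, hc, h⟩ ⟨d, hd, h'⟩
        exact ⟨d * c, mul_ne_zero hd hc, by rw [h', h, smul_smul]⟩ }
  exact he.eqvGen_iff.1 (Quot.eqvGen_exact h)

/-- Two null pairs with proportional dot and cross products have orthogonal first members. -/
theorem dot_eq_zero_of_proportional_left {a b a' b' : Fin 3 → ℂ} {c : ℂ} (hc : c ≠ 0)
    (haa : a ⬝ᵥ a = 0) (haa' : a' ⬝ᵥ a' = 0) (hn : a ⬝ᵥ b ≠ 0)
    (hdot : a' ⬝ᵥ b' = c * (a ⬝ᵥ b))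
    (hcross : crossProduct a' b' = c • crossProduct a b) : a ⬝ᵥ a' = 0 := by
  have h1 : crossProduct (crossProduct a b) a = -(a ⬝ᵥ b) • a := by
    rw [cross_cross_eq_smul_sub_smul, haa, dotProduct_comm b a]
    simp
  have h2 : crossProduct (crossProduct a' b') a' = -(a' ⬝ᵥ b') • a' := by
    rw [cross_cross_eq_smul_sub_smul, haa', dotProduct_comm b' a']
    simp
  rw [hcross, hdot] at h2
  have h3 : c * (a ⬝ᵥ b) * (a ⬝ᵥ a') = 0 := by
    generalize crossProduct a b = d at *
    generalize a ⬝ᵥ b = n at *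
    have e0 := congrFun h1 0
    have e1 := congrFun h1 1
    have e2 := congrFun h1 2
    have f0 := congrFun h2 0
    have f1 := congrFun h2 1
    have f2 := congrFun h2 2
    simp only [cross_apply, Matrix.cons_val, Pi.smul_apply, smul_eq_mul] at e0 e1 e2 f0 f1 f2
    simp only [dotProduct, Fin.sum_univ_three]
    linear_combination (c * (a' 0 * e0 + a' 1 * e1 + a' 2 * e2) +
      (a 0 * f0 + a 1 * f1 + a 2 * f2)) / 2
  exact (mul_eq_zero.1 h3).resolve_left (mul_ne_zero hc hn)

theorem dot_eq_zero_of_proportional_right {a b a' b' : Fin 3 → ℂ} {c : ℂ} (hc : c ≠ 0)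
    (hbb : b ⬝ᵥ b = 0) (hbb' : b' ⬝ᵥ b' = 0) (hn : a ⬝ᵥ b ≠ 0)
    (hdot : a' ⬝ᵥ b' = c * (a ⬝ᵥ b))
    (hcross : crossProduct a' b' = c • crossProduct a b) : b ⬝ᵥ b' = 0 := by
  refine dot_eq_zero_of_proportional_left (b := a) (b' := a') hc hbb hbb' ?_ ?_ ?_
  · rwa [dotProduct_comm]
  · rw [dotProduct_comm, hdot, dotProduct_comm a b]
  · rw [← cross_anticomm, hcross, ← cross_anticomm a b, smul_neg]

theorem brel_of_phiRep_eq {ξ ξ' : CQset} (h : phiRep ξ = phiRep ξ') : brel ξ ξ' := by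
  by_cases h0 : ∑ k, bN (ξ.1 k) = 0 <;> by_cases h0' : ∑ k, bN (ξ'.1 k) = 0
  · rw [phiRep_of_eq h0, phiRep_of_eq h0'] at h
    obtain ⟨c, hc, h⟩ := q2rel_of_mk_eq h
    have hA : idemA ξ'.1 = c • idemA ξ.1 := by
      ext k
      have h1 := congrFun h k.succ
      fin_cases k <;> exact h1
    rw [sum_bN_eq] at h0 h0'
    obtain ⟨s, hs, hs'⟩ := exists_smul_of_null (idemA_ne_zero ξ.2) (idemB_ne_zero ξ.2)
      (idemA_null ξ.2) (idemB_null ξ.2) h0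
    obtain ⟨t, -, ht'⟩ := exists_smul_of_null (idemA_ne_zero ξ'.2) (idemB_ne_zero ξ'.2)
      (idemA_null ξ'.2) (idemB_null ξ'.2) h0'
    refine brel_of_idem hA (β := t * c * s⁻¹) ?_
    rw [ht', hA, hs', smul_smul, smul_smul, mul_assoc (t * c), inv_mul_cancel₀ hs, mul_one]
  · rw [phiRep_of_eq h0, phiRep_of_ne h0'] at h
    obtain ⟨c, hc, h⟩ := q2rel_of_mk_eq h
    exact absurd (by simpa [phiVec, infVec] using congrFun h 0) h0'
  · rw [phiRep_of_ne h0, phiRep_of_eq h0'] at h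
    obtain ⟨c, hc, h⟩ := q2rel_of_mk_eq h
    have h1 : 0 = c * ∑ k, bN (ξ.1 k) := congrFun h 0
    exact absurd h1.symm (mul_ne_zero hc h0)
  · rw [phiRep_of_ne h0, phiRep_of_ne h0'] at h
    obtain ⟨c, hc, h⟩ := q2rel_of_mk_eq h
    simp only [phiVec_eq] at h
    rw [sum_bN_eq] at h0
    have hdot : idemA ξ'.1 ⬝ᵥ idemB ξ'.1 = c * (idemA ξ.1 ⬝ᵥ idemB ξ.1) := congrFun h 0
    have hcross : crossProduct (idemA ξ'.1) (idemB ξ'.1) =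
        c • crossProduct (idemA ξ.1) (idemB ξ.1) := by
      ext k
      have h1 : -I * crossProduct (idemA ξ'.1) (idemB ξ'.1) k =
          c * (-I * crossProduct (idemA ξ.1) (idemB ξ.1) k) := by
        have h1 := congrFun h k.succ
        fin_cases k <;> exact h1
      apply mul_left_cancel₀ (neg_ne_zero.2 I_ne_zero)
      rw [h1, Pi.smul_apply, smul_eq_mul]
      ring
    obtain ⟨α, -, hα⟩ := exists_smul_of_null (idemA_ne_zero ξ.2) (idemA_ne_zero ξ'.2)
      (idemA_null ξ.2) (idemA_null ξ'.2)
      (dot_eq_zero_of_proportional_left hc (idemA_null ξ.2) (idemA_null ξ'.2) h0 hdot hcross)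
    obtain ⟨β, -, hβ⟩ := exists_smul_of_null (idemB_ne_zero ξ.2) (idemB_ne_zero ξ'.2)
      (idemB_null ξ.2) (idemB_null ξ'.2)
      (dot_eq_zero_of_proportional_right hc (idemB_null ξ.2) (idemB_null ξ'.2) h0 hdot hcross)
    exact brel_of_idem hα hβ

/-- Segre parametrization of the affine cone over the complex quadric off `n = 0`. -/
theorem exists_segre {n x y z : ℂ} (hn : n ≠ 0) (h : n ^ 2 = x ^ 2 + y ^ 2 + z ^ 2) :
    ∃ m p q r s : ℂ, n = m * (p * r + q * s) / 2 ∧ x = m * (p * s + q * r) / 2 ∧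
      y = I * m * (p * s - q * r) / 2 ∧ z = m * (p * r - q * s) / 2 := by
  by_cases hz : n + z = 0
  · have hz' : n - z ≠ 0 := fun h1 => hn (by linear_combination (hz + h1) / 2)
    refine ⟨n - z, (x - I * y) / (n - z), 1, (x + I * y) / (n - z), 1, ?_, ?_, ?_, ?_⟩ <;>
      field_simp
    · linear_combination h + y ^ 2 * I_sq
    · ring
    · linear_combination 2 * y * I_sq
    · linear_combination h + y ^ 2 * I_sq
  · refine ⟨n + z, 1, (x + I * y) / (n + z), 1, (x - I * y) / (n + z), ?_, ?_, ?_, ?_⟩ <;>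
      field_simp
    · linear_combination h + y ^ 2 * I_sq
    · ring
    · linear_combination 2 * y * I_sq
    · linear_combination -h - y ^ 2 * I_sq

/-- The bicomplex vector with idempotent components `a` and `b`. -/
def ofIdem (a b : Fin 3 → ℂ) : Fin 3 → ℂ × ℂ := fun k => ((a k + b k) / 2, I * (a k - b k) / 2)

theorem idemA_ofIdem (a b : Fin 3 → ℂ) : idemA (ofIdem a b) = a := by
  ext k
  simp only [idemA, ofIdem]
  linear_combination -(a k - b k) / 2 * I_sq

theorem idemB_ofIdem (a b : Fin 3 → ℂ) : idemB (ofIdem a b) = b := by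
  ext k
  simp only [idemB, ofIdem]
  linear_combination (a k - b k) / 2 * I_sq

theorem phiRep_surjective (t : Quot q2rel) : ∃ ξ : CQset, phiRep ξ = t := by
  obtain ⟨⟨ζ, hζ⟩, rfl⟩ := Quot.exists_rep t
  by_cases h0 : ζ 0 = 0
  · set w : Fin 3 → ℂ := ![ζ 1, ζ 2, ζ 3] with hw
    have hζw : ζ = infVec w := by
      ext k
      fin_cases k <;> simp [infVec, hw, h0]
    have hw0 : w ≠ 0 := by
      intro h
      apply hζ.1
      rw [hζw, h]
      ext k
      fin_cases k <;> rfl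
    have hww : w ⬝ᵥ w = 0 := by
      simp only [dotProduct, Fin.sum_univ_three, hw, Matrix.cons_val]
      linear_combination -hζ.2 + ζ 0 * h0
    have hmem : ofIdem w w ∈ CQset := by
      refine ⟨fun h => hw0 ?_, ?_⟩
      · ext k
        simpa [bN_eq, idemA_ofIdem, idemB_ofIdem] using h k
      · rw [sum_bmul_self_eq_zero_iff, idemA_ofIdem, idemB_ofIdem]
        exact ⟨hww, hww⟩
    refine ⟨⟨_, hmem⟩, ?_⟩
    rw [phiRep_of_eq (by simp only [sum_bN_eq, idemA_ofIdem, idemB_ofIdem, hww])]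
    congr 1
    simp only [idemA_ofIdem, hζw]
  · obtain ⟨m, p, q, r, s, hn, hx, hy, hz⟩ := exists_segre h0 hζ.2
    have hm : m ≠ 0 := by
      rintro rfl
      simp [hn] at h0
    have hD : p * r + q * s ≠ 0 := by
      intro h
      simp [hn, h] at h0
    obtain ⟨a, ha⟩ : ∃ a : Fin 3 → ℂ, a = ![r ^ 2 - s ^ 2, -I * (r ^ 2 + s ^ 2), -2 * r * s] :=
      ⟨_, rfl⟩
    obtain ⟨b, hb⟩ : ∃ b : Fin 3 → ℂ, b = ![p ^ 2 - q ^ 2, I * (p ^ 2 + q ^ 2), -2 * p * q] :=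
      ⟨_, rfl⟩
    have haa : a ⬝ᵥ a = 0 := by
      simp only [dotProduct, Fin.sum_univ_three, ha, Matrix.cons_val]
      linear_combination (r ^ 2 + s ^ 2) ^ 2 * I_sq
    have hbb : b ⬝ᵥ b = 0 := by
      simp only [dotProduct, Fin.sum_univ_three, hb, Matrix.cons_val]
      linear_combination (p ^ 2 + q ^ 2) ^ 2 * I_sq
    have hab : a ⬝ᵥ b = 2 * (p * r + q * s) ^ 2 := by
      simp only [dotProduct, Fin.sum_univ_three, ha, hb, Matrix.cons_val]
      linear_combination -(r ^ 2 + s ^ 2) * (p ^ 2 + q ^ 2) * I_sq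
    have hN : ∑ k, bN (ofIdem a b k) ≠ 0 := by
      rw [sum_bN_eq, idemA_ofIdem, idemB_ofIdem, hab]
      exact mul_ne_zero two_ne_zero (pow_ne_zero 2 hD)
    have hmem : ofIdem a b ∈ CQset := by
      refine ⟨fun h => hN (Finset.sum_eq_zero fun k _ => h k), ?_⟩
      rw [sum_bmul_self_eq_zero_iff, idemA_ofIdem, idemB_ofIdem]
      exact ⟨haa, hbb⟩
    refine ⟨⟨_, hmem⟩, ?_⟩
    rw [phiRep_of_ne (ξ := ⟨ofIdem a b, hmem⟩) hN]
    have hD4 : 4 * (p * r + q * s) ≠ 0 := mul_ne_zero (by norm_num) hD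
    refine Quot.sound ⟨m / (4 * (p * r + q * s)), div_ne_zero hm hD4, ?_⟩
    simp only [phiVec_eq, idemA_ofIdem, idemB_ofIdem, hab]
    ext k
    rw [Pi.smul_apply, smul_eq_mul, div_mul_eq_mul_div, eq_div_iff hD4]
    fin_cases k <;>
      simp only [ha, hb, cross_apply, Matrix.cons_val, Fin.zero_eta, Fin.mk_one, Fin.reduceFinMk,
        hn, hx, hy, hz]
    · ring
    · linear_combination 2 * m * (p * r + q * s) * (p * s + q * r) * I_sq
    · ring
    · linear_combination 2 * m * (p * r + q * s) * (p * r - q * s) * I_sq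

/-- the map `φ : Q¹_𝔹 → Q²_ℂ`, given on `𝒩(ξ) ≠ 0` by
`[ξ] ↦ [𝒩(ξ), 2(u×v)]` and on `𝒩(ξ) = 0` by `[ξ] ↦ [0, w]` for a complex
representative `w` of `ξ`, is well-defined and bijective. -/
theorem Q1B_equiv_Q2C :
    ∃ F : Q1B → Q2C, Function.Bijective F ∧
      (∀ (ξ : Fin 3 → ℂ × ℂ) (h : ξ ∈ CQset), (∑ k, bN (ξ k)) ≠ 0 →
        ∀ hm : (![∑ k, bN (ξ k),
            2 * crossProduct (uPart ξ) (vPart ξ) 0,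
            2 * crossProduct (uPart ξ) (vPart ξ) 1,
            2 * crossProduct (uPart ξ) (vPart ξ) 2] : Fin 4 → ℂ) ∈ Q2Cset,
          F (Quot.mk brel ⟨ξ, h⟩) =
            Quot.mk q2rel ⟨![∑ k, bN (ξ k),
              2 * crossProduct (uPart ξ) (vPart ξ) 0,
              2 * crossProduct (uPart ξ) (vPart ξ) 1,
              2 * crossProduct (uPart ξ) (vPart ξ) 2], hm⟩) ∧
      (∀ (ξ : Fin 3 → ℂ × ℂ) (h : ξ ∈ CQset) (w : Fin 3 → ℂ) (lam : ℂ × ℂ),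
        (∑ k, bN (ξ k)) = 0 → w ≠ 0 → (∑ k, w k ^ 2) = 0 → bN lam ≠ 0 →
        (∀ k, ξ k = bmul lam ((w k), (0 : ℂ))) →
        ∀ hm : (![0, w 0, w 1, w 2] : Fin 4 → ℂ) ∈ Q2Cset,
          F (Quot.mk brel ⟨ξ, h⟩) = Quot.mk q2rel ⟨![0, w 0, w 1, w 2], hm⟩) := by
  refine ⟨Quot.lift phiRep phiRep_congr, ⟨?_, ?_⟩, ?_, ?_⟩
  · rintro ⟨ξ⟩ ⟨ξ'⟩ h
    exact Quot.sound (brel_of_phiRep_eq h)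
  · intro t
    obtain ⟨ξ, hξ⟩ := phiRep_surjective t
    exact ⟨Quot.mk brel ξ, hξ⟩
  · intro ξ h hN hm
    exact phiRep_of_ne (ξ := ⟨ξ, h⟩) hN
  · intro ξ h w lam hN hw hww hlam hξ hm
    refine (phiRep_of_eq (ξ := ⟨ξ, h⟩) hN).trans (Eq.symm (Quot.sound ?_))
    have hA : idemA ξ = (lam.1 - I * lam.2) • w := by
      rw [idemA_bmul (ξ := fun k => (w k, 0)) hξ]
      congr 1
      ext k
      simp [idemA]
    refine ⟨lam.1 - I * lam.2, fun h0 => hlam ?_, ?_⟩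
    · rw [bN]
      linear_combination (lam.1 + I * lam.2) * h0 + lam.2 ^ 2 * I_sq
    · simp only [hA, infVec_smul]
      rfl
end
end

section
/- Let U ⊆ ℂ³ be open with z₂² + z₃² ≠ 0 and z₁² + z₂² + z₃² ≠ 0 at every point of U, and let s : U → ℂ be a holomorphic function with s(z)² = z₁² + z₂² + z₃². For ε ∈ {1, −1, j, −j} ⊆ 𝔹 (where j := i₁i₂ = (0,i), j² = 1), define Φ_ε : U → 𝔹 by Φ_ε(z) = (−z₁ + ε·s(z))·(z₂ − z₃i₂)⁻¹. Then each Φ_ε satisfies the quadratic equation (z₂ − z₃i₂)·Φ_ε² + 2z₁·Φ_ε − (z₂ + z₃i₂) = 0 on U and is a complex-harmonic morphism U → 𝔹 = ℂ². Moreover, for ε = ±j one has 𝒩(Φ_ε(z)) = −1 for all z ∈ U, so Φ_ε is degenerate at every point of U. -/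
noncomputable section

/-- Complex Laplacian of `f : ℂ^m → ℂ`. -/
def lapC {m : ℕ} (f : (Fin m → ℂ) → ℂ) (p : Fin m → ℂ) : ℂ :=
  ∑ k, fderiv ℂ (fun z => fderiv ℂ f z (Pi.single k 1)) p (Pi.single k 1)

/-- Complex gradient of `f : ℂ^m → ℂ`. -/
def gradC {m : ℕ} (f : (Fin m → ℂ) → ℂ) (p : Fin m → ℂ) : Fin m → ℂ :=
  fun k => fderiv ℂ f p (Pi.single k 1)

/-- Complex-bilinear inner product on `ℂ^m`. -/
def innC {m : ℕ} (u v : Fin m → ℂ) : ℂ := ∑ k, u k * v k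

/-- Complex-harmonic (holomorphic) function on an open set `V ⊆ ℂ^m`. -/
def ComplexHarmonicOn {m : ℕ} (f : (Fin m → ℂ) → ℂ) (V : Set (Fin m → ℂ)) : Prop :=
  DifferentiableOn ℂ f V ∧ ∀ p ∈ V, lapC f p = 0

/-- Complex Laplacian of `f : ℂ² → ℂ` (coordinates `q₁, q₂` on `𝔹 = ℂ²`). -/
def lapB (f : ℂ × ℂ → ℂ) (p : ℂ × ℂ) : ℂ :=
  fderiv ℂ (fun w => fderiv ℂ f w ((1 : ℂ), (0 : ℂ))) p ((1 : ℂ), (0 : ℂ)) +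
  fderiv ℂ (fun w => fderiv ℂ f w ((0 : ℂ), (1 : ℂ))) p ((0 : ℂ), (1 : ℂ))

/-- Complex-harmonic function on an open set `V ⊆ ℂ² = 𝔹`. -/
def ComplexHarmonicOnB (f : ℂ × ℂ → ℂ) (V : Set (ℂ × ℂ)) : Prop :=
  DifferentiableOn ℂ f V ∧ ∀ p ∈ V, lapB f p = 0

/-- Complex-harmonic morphism `ℂ^m ⊇ U → ℂ² = 𝔹`: pulls back complex-harmonic
functions on open subsets of `ℂ²` to complex-harmonic functions. -/
def IsCHMB {m : ℕ} (Φ : (Fin m → ℂ) → ℂ × ℂ) (U : Set (Fin m → ℂ)) : Prop :=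
  ∀ V : Set (ℂ × ℂ), IsOpen V → ∀ f : ℂ × ℂ → ℂ,
    ComplexHarmonicOnB f V → (U ∩ Φ ⁻¹' V).Nonempty →
      ComplexHarmonicOn (f ∘ Φ) (U ∩ Φ ⁻¹' V)

/-- The bicomplex gradient `grad_ℂ Φ ∈ 𝔹^m` of `Φ : ℂ^m → 𝔹`. -/
def gradB {m : ℕ} (Φ : (Fin m → ℂ) → ℂ × ℂ) (p : Fin m → ℂ) : Fin m → ℂ × ℂ :=
  fun k => (fderiv ℂ (fun z => (Φ z).1) p (Pi.single k 1),
            fderiv ℂ (fun z => (Φ z).2) p (Pi.single k 1))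

/-- Bicomplex inverse `q⁻¹ = q^*/𝒩(q)` (valid when `𝒩(q) ≠ 0`). -/
def binv (q : ℂ × ℂ) : ℂ × ℂ := (q.1 / bN q, - q.2 / bN q)

/-- Directional derivatives of a holomorphic function on an open subset of a finite-dimensional
complex vector space are holomorphic. -/
theorem differentiableOn_fderiv_apply {E : Type*} [NormedAddCommGroup E] [NormedSpace ℂ E]
    [FiniteDimensional ℂ E] {f : E → ℂ} {V : Set E} (hV : IsOpen V)
    (hf : DifferentiableOn ℂ f V) (v : E) :
    DifferentiableOn ℂ (fun w => fderiv ℂ f w v) V := by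
  intro p hp
  apply DifferentiableAt.differentiableWithinAt
  obtain ⟨r, hr, hrV, hrb⟩ : ∃ r > 0, Metric.ball p r ⊆ V ∧
      ∀ w ∈ Metric.ball p r, f w ∈ Metric.ball (f p) 1 := by
    have h1 : ∀ᶠ w in nhds p, w ∈ V ∧ f w ∈ Metric.ball (f p) 1 :=
      Filter.Eventually.and (hV.mem_nhds hp)
        ((hf.differentiableAt (hV.mem_nhds hp)).continuousAt.eventually
          (Metric.ball_mem_nhds _ one_pos))
    obtain ⟨r, hr, h⟩ := Metric.eventually_nhds_iff_ball.1 h1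
    exact ⟨r, hr, fun w hw => (h w hw).1, fun w hw => (h w hw).2⟩
  have hdiff : ∀ w ∈ Metric.ball p r, DifferentiableAt ℂ f w := fun w hw =>
    hf.differentiableAt (hV.mem_nhds (hrV hw))
  have hbound : ∀ w ∈ Metric.ball p (3 * (r / 4)), ‖fderiv ℂ f w‖ ≤ 2 / (r / 4) := by
    intro w hw
    have hsub : Metric.ball w (r / 4) ⊆ Metric.ball p r := by
      apply Metric.ball_subset_ball'
      rw [Metric.mem_ball] at hw
      linarith
    refine Complex.norm_fderiv_le_div_of_mapsTo_ball
      (fun x hx => (hdiff x (hsub hx)).differentiableWithinAt) (fun x hx => ?_) (by positivity)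
    have h1 := hrb x (hsub hx)
    have h2 := hrb w (hsub (Metric.mem_ball_self (by positivity)))
    rw [Metric.mem_ball] at h1 h2
    rw [Metric.mem_closedBall]
    linarith [dist_triangle_right (f x) (f w) (f p)]
  set R : ℝ := r / 4 / (‖v‖ + 1) with hR
  have hv : 0 < ‖v‖ + 1 := by positivity
  have hRpos : 0 < R := by positivity
  have hshift : ∀ w ∈ Metric.ball p (r / 4), ∀ ζ ∈ Metric.closedBall (0 : ℂ) R,
      w + ζ • v ∈ Metric.ball p (3 * (r / 4)) := by
    intro w hw ζ hζ
    rw [mem_closedBall_zero_iff] at hζ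
    rw [Metric.mem_ball, dist_eq_norm] at hw ⊢
    have h1 : ‖ζ • v‖ ≤ r / 4 := by
      rw [norm_smul]
      calc ‖ζ‖ * ‖v‖ ≤ R * (‖v‖ + 1) := by gcongr; linarith
        _ = r / 4 := by rw [hR]; field_simp
    calc ‖w + ζ • v - p‖ = ‖(w - p) + ζ • v‖ := by congr 1; abel
      _ ≤ ‖w - p‖ + ‖ζ • v‖ := norm_add_le _ _
      _ < 3 * (r / 4) := by linarith
  have hsmall : Metric.ball p (3 * (r / 4)) ⊆ Metric.ball p r :=
    Metric.ball_subset_ball (by linarith)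
  have hcauchy : ∀ w ∈ Metric.ball p (r / 4), fderiv ℂ f w v =
      (2 * Real.pi * Complex.I : ℂ)⁻¹ • ∮ ζ in C(0, R), ((ζ - 0) ^ 2)⁻¹ • f (w + ζ • v) := by
    intro w hw
    have hline : ∀ ζ ∈ Metric.closedBall (0 : ℂ) R,
        HasDerivAt (fun ζ : ℂ => f (w + ζ • v)) (fderiv ℂ f (w + ζ • v) v) ζ := by
      intro ζ hζ
      have h1 : HasDerivAt (fun ζ : ℂ => w + ζ • v) v ζ := by
        simpa using ((hasDerivAt_id ζ).smul_const v).const_add w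
      exact (hdiff _ (hsmall (hshift w hw ζ hζ))).hasFDerivAt.comp_hasDerivAt ζ h1
    have h0 := hline 0 (Metric.mem_closedBall_self hRpos.le)
    have hd : DifferentiableOn ℂ (fun ζ : ℂ => f (w + ζ • v)) (Metric.closedBall 0 R) :=
      fun ζ hζ => (hline ζ hζ).differentiableAt.differentiableWithinAt
    have := hd.deriv_eq_smul_circleIntegral hRpos
    rw [h0.deriv, zero_smul, add_zero] at this
    rw [eq_inv_smul_iff₀ Complex.two_pi_I_ne_zero, ← this]
    simp only [one_div]
  have hev : (fun w => fderiv ℂ f w v) =ᶠ[nhds p] fun w =>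
      (2 * Real.pi * Complex.I : ℂ)⁻¹ • ∮ ζ in C(0, R), ((ζ - 0) ^ 2)⁻¹ • f (w + ζ • v) :=
    Filter.eventually_of_mem (Metric.ball_mem_nhds p (by positivity)) hcauchy
  refine DifferentiableAt.congr_of_eventuallyEq ?_ hev
  refine DifferentiableAt.fun_const_smul ?_ _
  simp only [circleIntegral, intervalIntegral.integral_of_le Real.two_pi_pos.le]
  have hmem : ∀ θ : ℝ, circleMap 0 R θ ∈ Metric.closedBall (0 : ℂ) R :=
    fun θ => circleMap_mem_closedBall 0 hRpos.le θ
  have hnorm : ∀ θ : ℝ, ‖deriv (circleMap 0 R) θ * ((circleMap 0 R θ - 0) ^ 2)⁻¹‖ = R⁻¹ := by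
    intro θ
    simp [deriv_circleMap, abs_of_pos hRpos]
    field_simp
  have hcont : ∀ w ∈ Metric.ball p (r / 4), Continuous fun θ : ℝ =>
      deriv (circleMap 0 R) θ • ((circleMap 0 R θ - 0) ^ 2)⁻¹ • f (w + circleMap 0 R θ • v) := by
    intro w hw
    have h1 : Continuous fun θ : ℝ => f (w + circleMap 0 R θ • v) := by
      rw [continuous_iff_continuousAt]
      intro θ
      refine ContinuousAt.comp (f := fun θ : ℝ => w + circleMap 0 R θ • v)
        (hdiff _ (hsmall (hshift w hw _ (hmem θ)))).continuousAt ?_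
      fun_prop
    have h2 : Continuous fun θ : ℝ => ((circleMap 0 R θ - 0) ^ 2)⁻¹ := by
      refine Continuous.inv₀ (by fun_prop) fun θ => ?_
      simpa using hRpos.ne'
    have h3 : Continuous (deriv (circleMap 0 R)) := by
      have : deriv (circleMap 0 R) = fun θ => circleMap 0 R θ * Complex.I := by
        ext θ; simp [deriv_circleMap]
      rw [this]
      fun_prop
    exact h3.smul (h2.smul h1)
  borelize E
  have hmeas : Measurable fun θ : ℝ => fderiv ℂ f (p + circleMap 0 R θ • v) :=
    (measurable_fderiv ℂ f).comp (by fun_prop : Continuous _).measurable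
  have hp4 : p ∈ Metric.ball p (r / 4) := Metric.mem_ball_self (by positivity)
  have : ProperSpace (E →L[ℂ] ℂ) := FiniteDimensional.proper ℂ _
  refine (hasFDerivAt_integral_of_dominated_of_fderiv_le
    (F' := fun w θ => (deriv (circleMap 0 R) θ * ((circleMap 0 R θ - 0) ^ 2)⁻¹) •
      fderiv ℂ f (w + circleMap 0 R θ • v)) (bound := fun _ => R⁻¹ * (2 / (r / 4)))
    (Metric.ball_mem_nhds p (by positivity : 0 < r / 4)) ?_ ?_ ?_ ?_ ?_ ?_).differentiableAt
  · exact Filter.eventually_of_mem (Metric.ball_mem_nhds p (by positivity : 0 < r / 4))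
      fun w hw => (hcont w hw).aestronglyMeasurable
  · exact (hcont p hp4).integrableOn_Ioc
  · refine Measurable.aestronglyMeasurable (Measurable.fun_smul ?_ hmeas)
    exact (measurable_deriv _).mul (by fun_prop)
  · refine Filter.Eventually.of_forall fun θ w hw => ?_
    rw [norm_smul, hnorm]
    gcongr
    exact hbound _ (hshift w hw _ (hmem θ))
  · exact MeasureTheory.integrable_const _
  · refine Filter.Eventually.of_forall fun θ w hw => ?_
    have h1 := (hdiff _ (hsmall (hshift w hw _ (hmem θ)))).hasFDerivAt
    have h2 : HasFDerivAt (fun w => f (w + circleMap 0 R θ • v))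
        (fderiv ℂ f (w + circleMap 0 R θ • v)) w := by
      have h3 := h1.comp w ((hasFDerivAt_id w).add_const (circleMap 0 R θ • v))
      rwa [ContinuousLinearMap.comp_id] at h3
    simpa only [smul_smul, smul_eq_mul, mul_assoc] using
      h2.fun_const_smul (deriv (circleMap 0 R) θ * ((circleMap 0 R θ - 0) ^ 2)⁻¹)

theorem fderiv_comp_prod_apply {E : Type*} [NormedAddCommGroup E] [NormedSpace ℂ E]
    {g : ℂ × ℂ → ℂ} {Φ : E → ℂ × ℂ} {p : E} (hg : DifferentiableAt ℂ g (Φ p))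
    (hΦ : DifferentiableAt ℂ Φ p) (v : E) :
    fderiv ℂ (fun z => g (Φ z)) p v =
      fderiv ℂ g (Φ p) ((1 : ℂ), (0 : ℂ)) * fderiv ℂ (fun z => (Φ z).1) p v +
      fderiv ℂ g (Φ p) ((0 : ℂ), (1 : ℂ)) * fderiv ℂ (fun z => (Φ z).2) p v := by
  have h := (hg.hasFDerivAt.comp p hΦ.hasFDerivAt).fderiv
  have h1 : fderiv ℂ (fun z => (Φ z).1) p v = (fderiv ℂ Φ p v).1 := by
    rw [hΦ.hasFDerivAt.fst.fderiv]; rfl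
  have h2 : fderiv ℂ (fun z => (Φ z).2) p v = (fderiv ℂ Φ p v).2 := by
    rw [hΦ.hasFDerivAt.snd.fderiv]; rfl
  have h3 : fderiv ℂ Φ p v = (fderiv ℂ Φ p v).1 • ((1 : ℂ), (0 : ℂ)) +
      (fderiv ℂ Φ p v).2 • ((0 : ℂ), (1 : ℂ)) := by
    ext <;> simp
  rw [h1, h2]
  change fderiv ℂ (g ∘ Φ) p v = _
  rw [h, ContinuousLinearMap.comp_apply]
  conv_lhs => rw [h3]
  simp only [map_add, map_smul, smul_eq_mul]
  ring

/-- A holomorphic map whose components are complex-harmonic, with complex-orthogonal gradients of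
equal complex norm, is a complex-harmonic morphism. -/
theorem isCHMB_of_conformal {m : ℕ} {Φ : (Fin m → ℂ) → ℂ × ℂ} {U : Set (Fin m → ℂ)}
    (hU : IsOpen U) (hΦ : DifferentiableOn ℂ Φ U)
    (h1 : ∀ z ∈ U, lapC (fun z => (Φ z).1) z = 0)
    (h2 : ∀ z ∈ U, lapC (fun z => (Φ z).2) z = 0)
    (hnorm : ∀ z ∈ U, innC (gradC (fun z => (Φ z).1) z) (gradC (fun z => (Φ z).1) z) =
      innC (gradC (fun z => (Φ z).2) z) (gradC (fun z => (Φ z).2) z))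
    (horth : ∀ z ∈ U, innC (gradC (fun z => (Φ z).1) z) (gradC (fun z => (Φ z).2) z) = 0) :
    IsCHMB Φ U := by
  rintro V hV f ⟨hf, hlap⟩ -
  have hW : IsOpen (U ∩ Φ ⁻¹' V) := hΦ.continuousOn.isOpen_inter_preimage hU hV
  have hΦat : ∀ z ∈ U ∩ Φ ⁻¹' V, DifferentiableAt ℂ Φ z := fun z hz =>
    hΦ.differentiableAt (hU.mem_nhds hz.1)
  have hVat : ∀ g : ℂ × ℂ → ℂ, DifferentiableOn ℂ g V → ∀ z ∈ U ∩ Φ ⁻¹' V,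
      DifferentiableAt ℂ g (Φ z) := fun g hg z hz => hg.differentiableAt (hV.mem_nhds hz.2)
  refine ⟨fun z hz => ((hVat f hf z hz).comp z (hΦat z hz)).differentiableWithinAt, fun p hp => ?_⟩
  have hA := differentiableOn_fderiv_apply hV hf ((1 : ℂ), (0 : ℂ))
  have hB := differentiableOn_fderiv_apply hV hf ((0 : ℂ), (1 : ℂ))
  set A : ℂ × ℂ → ℂ := fun w => fderiv ℂ f w ((1 : ℂ), (0 : ℂ)) with hAdef
  set B : ℂ × ℂ → ℂ := fun w => fderiv ℂ f w ((0 : ℂ), (1 : ℂ)) with hBdef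
  have hterm : ∀ v, fderiv ℂ (fun z => fderiv ℂ (f ∘ Φ) z v) p v =
      (fderiv ℂ A (Φ p) ((1 : ℂ), (0 : ℂ)) * fderiv ℂ (fun z => (Φ z).1) p v +
        fderiv ℂ A (Φ p) ((0 : ℂ), (1 : ℂ)) * fderiv ℂ (fun z => (Φ z).2) p v) *
          fderiv ℂ (fun z => (Φ z).1) p v +
      A (Φ p) * fderiv ℂ (fun z => fderiv ℂ (fun z => (Φ z).1) z v) p v +
      ((fderiv ℂ B (Φ p) ((1 : ℂ), (0 : ℂ)) * fderiv ℂ (fun z => (Φ z).1) p v +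
        fderiv ℂ B (Φ p) ((0 : ℂ), (1 : ℂ)) * fderiv ℂ (fun z => (Φ z).2) p v) *
          fderiv ℂ (fun z => (Φ z).2) p v +
      B (Φ p) * fderiv ℂ (fun z => fderiv ℂ (fun z => (Φ z).2) z v) p v) := by
    intro v
    have hev : (fun z => fderiv ℂ (f ∘ Φ) z v) =ᶠ[nhds p] fun z =>
        A (Φ z) * fderiv ℂ (fun z => (Φ z).1) z v + B (Φ z) * fderiv ℂ (fun z => (Φ z).2) z v :=
      Filter.eventually_of_mem (hW.mem_nhds hp) fun z hz =>
        fderiv_comp_prod_apply (hVat f hf z hz) (hΦat z hz) v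
    have hAΦ : DifferentiableAt ℂ (fun z => A (Φ z)) p := (hVat A hA p hp).comp p (hΦat p hp)
    have hBΦ : DifferentiableAt ℂ (fun z => B (Φ z)) p := (hVat B hB p hp).comp p (hΦat p hp)
    have hD1 := (differentiableOn_fderiv_apply hU hΦ.fst v).differentiableAt (hU.mem_nhds hp.1)
    have hD2 := (differentiableOn_fderiv_apply hU hΦ.snd v).differentiableAt (hU.mem_nhds hp.1)
    rw [hev.fderiv_eq, fderiv_fun_add (hAΦ.fun_mul hD1) (hBΦ.fun_mul hD2),
      fderiv_fun_mul hAΦ hD1, fderiv_fun_mul hBΦ hD2,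
      ← fderiv_comp_prod_apply (hVat A hA p hp) (hΦat p hp),
      ← fderiv_comp_prod_apply (hVat B hB p hp) (hΦat p hp)]
    simp only [add_apply, smul_apply, smul_eq_mul]
    ring
  have hl : fderiv ℂ A (Φ p) ((1 : ℂ), (0 : ℂ)) + fderiv ℂ B (Φ p) ((0 : ℂ), (1 : ℂ)) = 0 :=
    hlap _ hp.2
  have e1 := h1 p hp.1
  have e2 := h2 p hp.1
  have e3 := hnorm p hp.1
  have e4 := horth p hp.1
  simp only [lapC, innC, gradC] at e1 e2 e3 e4
  simp only [lapC, hterm]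
  calc _ = fderiv ℂ A (Φ p) ((1 : ℂ), (0 : ℂ)) * ∑ k : Fin m,
          fderiv ℂ (fun z => (Φ z).1) p (Pi.single k 1) *
            fderiv ℂ (fun z => (Φ z).1) p (Pi.single k 1) +
        fderiv ℂ B (Φ p) ((0 : ℂ), (1 : ℂ)) * ∑ k : Fin m,
          fderiv ℂ (fun z => (Φ z).2) p (Pi.single k 1) *
            fderiv ℂ (fun z => (Φ z).2) p (Pi.single k 1) +
        (fderiv ℂ A (Φ p) ((0 : ℂ), (1 : ℂ)) + fderiv ℂ B (Φ p) ((1 : ℂ), (0 : ℂ))) *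
          ∑ k : Fin m, fderiv ℂ (fun z => (Φ z).1) p (Pi.single k 1) *
            fderiv ℂ (fun z => (Φ z).2) p (Pi.single k 1) +
        A (Φ p) * ∑ k : Fin m, fderiv ℂ (fun z => fderiv ℂ (fun z => (Φ z).1) z
          (Pi.single k 1)) p (Pi.single k 1) +
        B (Φ p) * ∑ k : Fin m, fderiv ℂ (fun z => fderiv ℂ (fun z => (Φ z).2) z
          (Pi.single k 1)) p (Pi.single k 1) := by
        simp only [Finset.mul_sum, ← Finset.sum_add_distrib]
        exact Finset.sum_congr rfl fun k _ => by ring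
    _ = 0 := by
        rw [e1, e2, e4, e3, mul_zero, mul_zero, mul_zero, add_zero, add_zero, add_zero,
          ← add_mul, hl, zero_mul]

theorem lapC_linear_combination {m : ℕ} {U : Set (Fin m → ℂ)} (hU : IsOpen U)
    {a b : (Fin m → ℂ) → ℂ} (ha : DifferentiableOn ℂ a U) (hb : DifferentiableOn ℂ b U) (c d : ℂ)
    {p : Fin m → ℂ} (hp : p ∈ U) :
    lapC (fun z => c * a z + d * b z) p = c * lapC a p + d * lapC b p := by
  simp only [lapC, Finset.mul_sum, ← Finset.sum_add_distrib]
  refine Finset.sum_congr rfl fun k _ => ?_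
  have hev : (fun z => fderiv ℂ (fun z => c * a z + d * b z) z (Pi.single k 1)) =ᶠ[nhds p]
      fun z => c * fderiv ℂ a z (Pi.single k 1) + d * fderiv ℂ b z (Pi.single k 1) := by
    filter_upwards [hU.mem_nhds hp] with z hz
    have h1 := (ha.differentiableAt (hU.mem_nhds hz)).hasFDerivAt
    have h2 := (hb.differentiableAt (hU.mem_nhds hz)).hasFDerivAt
    rw [((h1.const_mul c).fun_add (h2.const_mul d)).fderiv]
    simp
  have h1 := ((differentiableOn_fderiv_apply hU ha (Pi.single k 1)).differentiableAt
    (hU.mem_nhds hp)).hasFDerivAt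
  have h2 := ((differentiableOn_fderiv_apply hU hb (Pi.single k 1)).differentiableAt
    (hU.mem_nhds hp)).hasFDerivAt
  rw [hev.fderiv_eq, ((h1.const_mul c).fun_add (h2.const_mul d)).fderiv]
  simp

theorem gradC_linear_combination {m : ℕ} {a b : (Fin m → ℂ) → ℂ} {p : Fin m → ℂ}
    (ha : DifferentiableAt ℂ a p) (hb : DifferentiableAt ℂ b p) (c d : ℂ) (k : Fin m) :
    gradC (fun z => c * a z + d * b z) p k = c * gradC a p k + d * gradC b p k := by
  simp only [gradC]
  rw [((ha.hasFDerivAt.const_mul c).fun_add (hb.hasFDerivAt.const_mul d)).fderiv]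
  simp

/-- A function `a` with `((z₁ - τ z₂) a + z₀)² = z₀² + z₁² + z₂²`, where `τ² = -1`, is a root of
a quadratic polynomial. -/
theorem radialRoot_quadratic {τ α : ℂ} (hτ : τ ^ 2 = -1) {z : Fin 3 → ℂ} (hw : z 1 - τ * z 2 ≠ 0)
    (h : ((z 1 - τ * z 2) * α + z 0) ^ 2 = z 0 ^ 2 + z 1 ^ 2 + z 2 ^ 2) :
    (z 1 - τ * z 2) * α ^ 2 + 2 * z 0 * α - (z 1 + τ * z 2) = 0 := by
  apply mul_left_cancel₀ hw
  linear_combination h + z 2 ^ 2 * hτ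

section RadialRoot

variable {U : Set (Fin 3 → ℂ)} {a : (Fin 3 → ℂ) → ℂ} {τ : ℂ}

theorem radialRoot_gradC (hU : IsOpen U) (hτ : τ ^ 2 = -1) (ha : DifferentiableOn ℂ a U)
    (hw : ∀ z ∈ U, z 1 - τ * z 2 ≠ 0)
    (h : ∀ z ∈ U, ((z 1 - τ * z 2) * a z + z 0) ^ 2 = z 0 ^ 2 + z 1 ^ 2 + z 2 ^ 2)
    {p : Fin 3 → ℂ} (hp : p ∈ U) :
    ((p 1 - τ * p 2) * a p + p 0) * gradC a p 0 = -a p ∧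
    2 * ((p 1 - τ * p 2) * a p + p 0) * gradC a p 1 = 1 - a p ^ 2 ∧
    2 * ((p 1 - τ * p 2) * a p + p 0) * gradC a p 2 = τ * (1 + a p ^ 2) := by
  have h' := (ha.differentiableAt (hU.mem_nhds hp)).hasFDerivAt
  have hc : ∀ i : Fin 3, HasFDerivAt (fun z : Fin 3 → ℂ => z i)
      (ContinuousLinearMap.proj i : (Fin 3 → ℂ) →L[ℂ] ℂ) p := fun i => hasFDerivAt_apply i p
  have hsq : HasFDerivAt (fun z => a z ^ 2) ((2 * a p) • fderiv ℂ a p) p := by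
    simpa using h'.pow 2
  have hF := ((((hc 1).fun_sub ((hc 2).const_mul τ)).fun_mul hsq).fun_add
    (((hc 0).const_mul 2).fun_mul h')).fun_sub ((hc 1).fun_add ((hc 2).const_mul τ))
  have hev : (fun z => (z 1 - τ * z 2) * a z ^ 2 + 2 * z 0 * a z - (z 1 + τ * z 2))
      =ᶠ[nhds p] fun _ => 0 :=
    Filter.eventually_of_mem (hU.mem_nhds hp) fun z hz =>
      radialRoot_quadratic hτ (hw z hz) (h z hz)
  have hz := hF.unique ((hasFDerivAt_const (0 : ℂ) p).congr_of_eventuallyEq hev)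
  have hk : ∀ k : Fin 3, _ := fun k => DFunLike.congr_fun hz (Pi.single k 1)
  have h0 := hk 0
  have h1 := hk 1
  have h2 := hk 2
  simp at h0 h1 h2
  simp only [gradC]
  refine ⟨?_, ?_, ?_⟩
  · linear_combination h0 / 2
  · linear_combination h1
  · linear_combination h2

theorem radialRoot_innC_gradC (hU : IsOpen U) (hτ : τ ^ 2 = -1) (ha : DifferentiableOn ℂ a U)
    (hw : ∀ z ∈ U, z 1 - τ * z 2 ≠ 0)
    (h : ∀ z ∈ U, ((z 1 - τ * z 2) * a z + z 0) ^ 2 = z 0 ^ 2 + z 1 ^ 2 + z 2 ^ 2)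
    {p : Fin 3 → ℂ} (hp : p ∈ U) (hQ : p 0 ^ 2 + p 1 ^ 2 + p 2 ^ 2 ≠ 0) :
    innC (gradC a p) (gradC a p) = 0 := by
  obtain ⟨h0, h1, h2⟩ := radialRoot_gradC hU hτ ha hw h hp
  rw [← h p hp] at hQ
  apply mul_left_cancel₀ hQ
  simp only [innC, Fin.sum_univ_three]
  set S := (p 1 - τ * p 2) * a p + p 0
  linear_combination (S * gradC a p 0 - a p) * h0 +
    (2 * S * gradC a p 1 + (1 - a p ^ 2)) / 4 * h1 +
    (2 * S * gradC a p 2 + τ * (1 + a p ^ 2)) / 4 * h2 + (1 + a p ^ 2) ^ 2 / 4 * hτ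

theorem radialRoot_lapC (hU : IsOpen U) (hτ : τ ^ 2 = -1) (ha : DifferentiableOn ℂ a U)
    (hw : ∀ z ∈ U, z 1 - τ * z 2 ≠ 0)
    (h : ∀ z ∈ U, ((z 1 - τ * z 2) * a z + z 0) ^ 2 = z 0 ^ 2 + z 1 ^ 2 + z 2 ^ 2)
    {p : Fin 3 → ℂ} (hp : p ∈ U) (hQ : p 0 ^ 2 + p 1 ^ 2 + p 2 ^ 2 ≠ 0) :
    lapC a p = 0 := by
  obtain ⟨h0, h1, h2⟩ := radialRoot_gradC hU hτ ha hw h hp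
  have h' := (ha.differentiableAt (hU.mem_nhds hp)).hasFDerivAt
  have hc : ∀ i : Fin 3, HasFDerivAt (fun z : Fin 3 → ℂ => z i)
      (ContinuousLinearMap.proj i : (Fin 3 → ℂ) →L[ℂ] ℂ) p := fun i => hasFDerivAt_apply i p
  have hg : ∀ k : Fin 3, HasFDerivAt (fun z => gradC a z k)
      (fderiv ℂ (fun z => fderiv ℂ a z (Pi.single k 1)) p) p := fun k =>
    ((differentiableOn_fderiv_apply hU ha (Pi.single k 1)).differentiableAt
      (hU.mem_nhds hp)).hasFDerivAt
  have hS := (((hc 1).fun_sub ((hc 2).const_mul τ)).fun_mul h').fun_add (hc 0)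
  have hU' := hU.mem_nhds hp
  have hsq : HasFDerivAt (fun z => a z ^ 2) ((2 * a p) • fderiv ℂ a p) p := by
    simpa using h'.pow 2
  have e0 := ((hS.fun_mul (hg 0)).unique (h'.fun_neg.congr_of_eventuallyEq
    (Filter.eventually_of_mem hU' fun z hz => (radialRoot_gradC hU hτ ha hw h hz).1)))
  have e1 := (((hS.const_mul 2).fun_mul (hg 1)).unique
    ((hsq.const_sub 1).congr_of_eventuallyEq
    (Filter.eventually_of_mem hU' fun z hz => (radialRoot_gradC hU hτ ha hw h hz).2.1)))
  have e2 := (((hS.const_mul 2).fun_mul (hg 2)).unique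
    (((hsq.const_add 1).const_mul τ).congr_of_eventuallyEq
    (Filter.eventually_of_mem hU' fun z hz => (radialRoot_gradC hU hτ ha hw h hz).2.2)))
  replace e0 := DFunLike.congr_fun e0 (Pi.single 0 1)
  replace e1 := DFunLike.congr_fun e1 (Pi.single 1 1)
  replace e2 := DFunLike.congr_fun e2 (Pi.single 2 1)
  have hnull := radialRoot_innC_gradC hU hτ ha hw h hp hQ
  rw [← h p hp] at hQ
  apply mul_left_cancel₀ hQ
  simp only [lapC, innC, Fin.sum_univ_three, gradC] at h0 h1 h2 hnull ⊢
  simp [gradC] at e0 e1 e2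
  set S := (p 1 - τ * p 2) * a p + p 0
  linear_combination S * (e0 + e1 / 2 + e2 / 2) - S * (p 1 - τ * p 2) * hnull -
    2 * (h0 + a p / 2 * h1 - τ * a p / 2 * h2) + a p * (1 + a p ^ 2) * hτ

end RadialRoot

/-- complex radial projection: on a suitable open `U ⊆ ℂ³`, for each
`ε ∈ {1, −1, j, −j}` the map `Φ_ε(z) = (−z₁ + ε·s(z))·(z₂ − z₃ i₂)⁻¹`, where
`s(z)² = z₁² + z₂² + z₃²`, satisfies
`(z₂ − z₃ i₂)Φ_ε² + 2z₁Φ_ε − (z₂ + z₃ i₂) = 0` and is a complex-harmonic morphism;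
for `ε = ±j` one has `𝒩(Φ_ε) ≡ −1`, so `Φ_ε` is degenerate at every point of `U`. -/
theorem complex_radial_projection (U : Set (Fin 3 → ℂ)) (hU : IsOpen U)
    (h23 : ∀ z ∈ U, z 1 ^ 2 + z 2 ^ 2 ≠ 0)
    (h123 : ∀ z ∈ U, z 0 ^ 2 + z 1 ^ 2 + z 2 ^ 2 ≠ 0)
    (s : (Fin 3 → ℂ) → ℂ) (hs : DifferentiableOn ℂ s U)
    (hs2 : ∀ z ∈ U, s z ^ 2 = z 0 ^ 2 + z 1 ^ 2 + z 2 ^ 2)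
    (ε : ℂ × ℂ)
    (hε : ε = ((1 : ℂ), (0 : ℂ)) ∨ ε = ((-1 : ℂ), (0 : ℂ)) ∨
          ε = ((0 : ℂ), Complex.I) ∨ ε = ((0 : ℂ), -Complex.I))
    (Φ : (Fin 3 → ℂ) → ℂ × ℂ)
    (hΦdef : ∀ z ∈ U,
      Φ z = bmul (((-(z 0) : ℂ), (0 : ℂ)) + bmul ε ((s z), (0 : ℂ)))
        (binv ((z 1), (-(z 2))))) :
    (∀ z ∈ U,
      bmul ((z 1), (-(z 2))) (bmul (Φ z) (Φ z)) + bmul ((2 * z 0 : ℂ), (0 : ℂ)) (Φ z)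
        - ((z 1), (z 2)) = 0) ∧
    DifferentiableOn ℂ Φ U ∧ IsCHMB Φ U ∧
    ((ε = ((0 : ℂ), Complex.I) ∨ ε = ((0 : ℂ), -Complex.I)) →
      ∀ z ∈ U, bN (Φ z) = -1 ∧ fderiv ℂ Φ z ≠ 0 ∧ ∑ k, bN (gradB Φ z k) = 0) := by
  have hw : ∀ z ∈ U, z 1 - Complex.I * z 2 ≠ 0 := fun z hz h0 => h23 z hz <| by
    linear_combination (z 1 + Complex.I * z 2) * h0 + z 2 ^ 2 * Complex.I_sq
  have hw' : ∀ z ∈ U, z 1 - -Complex.I * z 2 ≠ 0 := fun z hz h0 => h23 z hz <| by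
    linear_combination (z 1 - Complex.I * z 2) * h0 + z 2 ^ 2 * Complex.I_sq
  have hτ : (-Complex.I) ^ 2 = -1 := by rw [neg_sq, Complex.I_sq]
  have hε1 : (ε.1 + Complex.I * ε.2) ^ 2 = 1 := by
    rcases hε with rfl | rfl | rfl | rfl <;> simp
  have hε2 : (ε.1 - Complex.I * ε.2) ^ 2 = 1 := by
    rcases hε with rfl | rfl | rfl | rfl <;> simp
  have hΦ : DifferentiableOn ℂ Φ U := by
    refine DifferentiableOn.congr ?_ hΦdef
    have hc : ∀ i : Fin 3, DifferentiableOn ℂ (fun z : Fin 3 → ℂ => z i) U := fun i => by fun_prop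
    have hN : ∀ z ∈ U, z 1 ^ 2 + (-z 2) ^ 2 ≠ 0 := fun z hz => by
      rw [neg_sq]
      exact h23 z hz
    simp only [bmul, binv, bN, Prod.fst_add, Prod.snd_add, div_eq_mul_inv]
    have hD : DifferentiableOn ℂ (fun z : Fin 3 → ℂ => z 1 ^ 2 + (-z 2) ^ 2) U :=
      ((hc 1).fun_pow 2).fun_add ((hc 2).fun_neg.fun_pow 2)
    have h1 := (hc 1).fun_mul (hD.fun_inv hN)
    have h2 := (hc 2).fun_neg.fun_neg.fun_mul (hD.fun_inv hN)
    have h3 := (hc 0).fun_neg.fun_add ((hs.const_mul ε.1).sub_const (ε.2 * 0))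
    have h4 := ((hs.const_mul ε.2).const_add (ε.1 * 0)).const_add 0
    exact ((h3.fun_mul h1).fun_sub (h4.fun_mul h2)).prodMk
      ((h3.fun_mul h2).fun_add (h4.fun_mul h1))
  set a : (Fin 3 → ℂ) → ℂ := fun z => (Φ z).1 + Complex.I * (Φ z).2 with hadef
  set b : (Fin 3 → ℂ) → ℂ := fun z => (Φ z).1 - Complex.I * (Φ z).2 with hbdef
  have ha : DifferentiableOn ℂ a U := hΦ.fst.fun_add (hΦ.snd.const_mul _)
  have hb : DifferentiableOn ℂ b U := hΦ.fst.fun_sub (hΦ.snd.const_mul _)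
  have hmul : ∀ z ∈ U, z 1 * (Φ z).1 + z 2 * (Φ z).2 = -z 0 + ε.1 * s z ∧
      z 1 * (Φ z).2 - z 2 * (Φ z).1 = ε.2 * s z := by
    intro z hz
    have hN := h23 z hz
    rw [hΦdef z hz]
    simp only [bmul, binv, bN, Prod.fst_add, Prod.snd_add, neg_sq]
    constructor <;> field_simp <;> ring
  have haS : ∀ z ∈ U, (z 1 - Complex.I * z 2) * a z + z 0 = (ε.1 + Complex.I * ε.2) * s z := by
    intro z hz
    obtain ⟨h1, h2⟩ := hmul z hz
    simp only [hadef]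
    linear_combination h1 + Complex.I * h2 - z 2 * (Φ z).2 * Complex.I_sq
  have hbS : ∀ z ∈ U, (z 1 - -Complex.I * z 2) * b z + z 0 = (ε.1 - Complex.I * ε.2) * s z := by
    intro z hz
    obtain ⟨h1, h2⟩ := hmul z hz
    simp only [hbdef]
    linear_combination h1 - Complex.I * h2 - z 2 * (Φ z).2 * Complex.I_sq
  have hsa : ∀ z ∈ U, ((z 1 - Complex.I * z 2) * a z + z 0) ^ 2 =
      z 0 ^ 2 + z 1 ^ 2 + z 2 ^ 2 := fun z hz => by
    rw [haS z hz, mul_pow, hε1, one_mul, hs2 z hz]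
  have hsb : ∀ z ∈ U, ((z 1 - -Complex.I * z 2) * b z + z 0) ^ 2 =
      z 0 ^ 2 + z 1 ^ 2 + z 2 ^ 2 := fun z hz => by
    rw [hbS z hz, mul_pow, hε2, one_mul, hs2 z hz]
  have hΦ1 : (fun z => (Φ z).1) = fun z => 1 / 2 * a z + 1 / 2 * b z := by
    ext z; simp only [hadef, hbdef]; ring
  have hΦ2 : (fun z => (Φ z).2) = fun z => -Complex.I / 2 * a z + Complex.I / 2 * b z := by
    ext z; simp only [hadef, hbdef]; linear_combination (Φ z).2 * Complex.I_sq
  have hat : ∀ z ∈ U, DifferentiableAt ℂ a z := fun z hz => ha.differentiableAt (hU.mem_nhds hz)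
  have hbt : ∀ z ∈ U, DifferentiableAt ℂ b z := fun z hz => hb.differentiableAt (hU.mem_nhds hz)
  have hanull : ∀ z ∈ U, innC (gradC a z) (gradC a z) = 0 := fun z hz =>
    radialRoot_innC_gradC hU Complex.I_sq ha hw hsa hz (h123 z hz)
  have hbnull : ∀ z ∈ U, innC (gradC b z) (gradC b z) = 0 := fun z hz =>
    radialRoot_innC_gradC hU hτ hb hw' hsb hz (h123 z hz)
  have halap : ∀ z ∈ U, lapC a z = 0 := fun z hz =>
    radialRoot_lapC hU Complex.I_sq ha hw hsa hz (h123 z hz)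
  have hblap : ∀ z ∈ U, lapC b z = 0 := fun z hz =>
    radialRoot_lapC hU hτ hb hw' hsb hz (h123 z hz)
  refine ⟨fun z hz => ?_, hΦ, isCHMB_of_conformal hU hΦ (fun z hz => ?_) (fun z hz => ?_)
    (fun z hz => ?_) (fun z hz => ?_), fun hj z hz => ?_⟩
  · have qa := radialRoot_quadratic Complex.I_sq (hw z hz) (hsa z hz)
    have qb := radialRoot_quadratic hτ (hw' z hz) (hsb z hz)
    simp only [hadef, hbdef] at qa qb
    ext
    · simp only [bmul, Prod.fst_add, Prod.fst_sub, Prod.fst_zero]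
      linear_combination qa / 2 + qb / 2 + (2 * z 2 * (Φ z).1 * (Φ z).2
        - z 1 * (Φ z).2 ^ 2) * Complex.I_sq
    · simp only [bmul, Prod.snd_add, Prod.snd_sub, Prod.snd_zero]
      linear_combination -Complex.I / 2 * qa + Complex.I / 2 * qb + (2 * z 1 * (Φ z).1 * (Φ z).2
        - z 2 * (Φ z).1 ^ 2 + 2 * z 0 * (Φ z).2 - z 2
        + z 2 * (Φ z).2 ^ 2 * (1 - Complex.I ^ 2)) * Complex.I_sq
  · rw [hΦ1, lapC_linear_combination hU ha hb _ _ hz, halap z hz, hblap z hz]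
    ring
  · rw [hΦ2, lapC_linear_combination hU ha hb _ _ hz, halap z hz, hblap z hz]
    ring
  · have h1 := hanull z hz
    have h2 := hbnull z hz
    rw [hΦ1, hΦ2]
    simp only [innC, gradC_linear_combination (hat z hz) (hbt z hz), Fin.sum_univ_three] at h1 h2 ⊢
    linear_combination (1 - Complex.I ^ 2) / 4 * (h1 + h2) +
      (gradC a z 0 * gradC b z 0 + gradC a z 1 * gradC b z 1 +
        gradC a z 2 * gradC b z 2) / 2 * Complex.I_sq
  · have h1 := hanull z hz
    have h2 := hbnull z hz
    rw [hΦ1, hΦ2]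
    simp only [innC, gradC_linear_combination (hat z hz) (hbt z hz), Fin.sum_univ_three] at h1 h2 ⊢
    linear_combination -Complex.I / 4 * h1 + Complex.I / 4 * h2
  · have hneg : ε.1 - Complex.I * ε.2 = -(ε.1 + Complex.I * ε.2) := by
      rcases hj with rfl | rfl <;> simp
    have hba : (z 1 - -Complex.I * z 2) * b z + z 0 =
        -((z 1 - Complex.I * z 2) * a z + z 0) := by
      rw [haS z hz, hbS z hz, hneg, neg_mul]
    have hab : a z * b z = -1 := by
      apply mul_left_cancel₀ (h23 z hz)
      linear_combination ((z 1 - Complex.I * z 2) * a z) * hba - hsa z hz +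
        a z * b z * z 2 ^ 2 * Complex.I_sq
    obtain ⟨a0, a1, a2⟩ := radialRoot_gradC hU Complex.I_sq ha hw hsa hz
    obtain ⟨b0, b1, b2⟩ := radialRoot_gradC hU hτ hb hw' hsb hz
    refine ⟨?_, fun h0 => ?_, ?_⟩
    · rw [← hab]
      simp only [bN, hadef, hbdef]
      linear_combination (Φ z).2 ^ 2 * Complex.I_sq
    · have hd := (hΦ.differentiableAt (hU.mem_nhds hz)).hasFDerivAt
      rw [h0] at hd
      have hda : gradC a z 0 = 0 := by
        simp only [gradC, hadef]
        rw [(hd.fst.fun_add (hd.snd.const_mul Complex.I)).fderiv]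
        simp
      rw [hda, mul_zero, eq_comm, neg_eq_zero] at a0
      rw [a0, zero_mul] at hab
      exact absurd hab (by norm_num)
    · have hQ := h123 z hz
      rw [← hsa z hz] at hQ
      rw [hba] at b0 b1 b2
      have hgrad : ∀ k, bN (gradB Φ z k) = gradC a z k * gradC b z k := by
        intro k
        change gradC (fun z => (Φ z).1) z k ^ 2 + gradC (fun z => (Φ z).2) z k ^ 2 = _
        rw [hΦ1, hΦ2, gradC_linear_combination (hat z hz) (hbt z hz),
          gradC_linear_combination (hat z hz) (hbt z hz)]
        linear_combination (gradC a z k - gradC b z k) ^ 2 / 4 * Complex.I_sq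
      simp only [hgrad, Fin.sum_univ_three]
      apply mul_left_cancel₀ hQ
      set S := (z 1 - Complex.I * z 2) * a z + z 0
      linear_combination S * gradC b z 0 * a0 + a z * b0 + S * gradC b z 1 / 2 * a1 -
        (1 - a z ^ 2) / 4 * b1 + S * gradC b z 2 / 2 * a2 -
        Complex.I * (1 + a z ^ 2) / 4 * b2 +
        (1 + a z ^ 2) * (1 + b z ^ 2) / 4 * Complex.I_sq - (1 + a z * b z) / 2 * hab
end
end

section
/- (Bicomplex Weierstrass formula.) Let ξ = (ξ₁, ξ₂, ξ₃) ∈ 𝔹³ satisfy ξ₁² + ξ₂² + ξ₃² = 0 and 𝒩(ξ₂ − ξ₃i₂) ≠ 0. Set H := (ξ₂ − ξ₃i₂)⁻¹ and G := −ξ₁·(ξ₂ − ξ₃i₂)⁻¹. Then 𝒩(H) ≠ 0 and (ξ₁, ξ₂, ξ₃) = (1/(2H))·(−2G, 1 − G², (1 + G²)i₂), i.e. ξ₁ = −G/H, ξ₂ = (1 − G²)/(2H), and ξ₃ = (1 + G²)i₂/(2H). -/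
noncomputable section

lemma bN_binv {q : ℂ × ℂ} (hq : bN q ≠ 0) : bN (binv q) = (bN q)⁻¹ := by
  have h : bN (binv q) = bN q / bN q ^ 2 := by
    change (q.1 / bN q) ^ 2 + (-q.2 / bN q) ^ 2 = (q.1 ^ 2 + q.2 ^ 2) / bN q ^ 2
    ring
  rw [h]
  field_simp

lemma bmul_binv_self {q : ℂ × ℂ} (hq : bN q ≠ 0) : bmul (binv q) q = (1, 0) := by
  ext <;> simp only [bmul, binv] <;> field_simp
  · simp only [bN]
    ring
  · ring

lemma binv_smul (c : ℂ) (q : ℂ × ℂ) : binv (c • q) = c⁻¹ • binv q := by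
  have h : bN (c • q) = c ^ 2 * bN q := by
    simp only [bN, Prod.smul_fst, Prod.smul_snd, smul_eq_mul]
    ring
  rcases eq_or_ne c 0 with rfl | hc
  · simp [binv]
  · ext <;> simp only [binv, h, Prod.smul_fst, Prod.smul_snd, smul_eq_mul] <;> field_simp

lemma binv_binv {q : ℂ × ℂ} (hq : bN q ≠ 0) : binv (binv q) = q := by
  have h : binv (binv q) =
      ((binv q).1 / bN (binv q), -(binv q).2 / bN (binv q)) := rfl
  rw [h, bN_binv hq]
  ext <;> simp only [binv] <;> field_simp

lemma bmul_comm (q w : ℂ × ℂ) : bmul q w = bmul w q := by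
  ext <;> simp only [bmul] <;> ring

lemma bmul_assoc (q w z : ℂ × ℂ) : bmul (bmul q w) z = bmul q (bmul w z) := by
  ext <;> simp only [bmul] <;> ring

lemma bmul_one (q : ℂ × ℂ) : bmul q (1, 0) = q := by
  ext <;> simp [bmul]

lemma bmul_sq_binv_eq {ξ₁ ξ₂ ξ₃ : ℂ × ℂ}
    (hnull : bmul ξ₁ ξ₁ + bmul ξ₂ ξ₂ + bmul ξ₃ ξ₃ = 0)
    (hden : bN (ξ₂ - bmul ξ₃ (0, 1)) ≠ 0) :
    bmul (bmul ξ₁ ξ₁) (binv (ξ₂ - bmul ξ₃ (0, 1))) = -(ξ₂ + bmul ξ₃ (0, 1)) := by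
  have hfactor : bmul ξ₁ ξ₁ =
      bmul (-(ξ₂ + bmul ξ₃ (0, 1))) (ξ₂ - bmul ξ₃ (0, 1)) := by
    have h₁ := congrArg Prod.fst hnull
    have h₂ := congrArg Prod.snd hnull
    simp only [bmul, Prod.fst_add, Prod.snd_add, Prod.fst_zero, Prod.snd_zero] at h₁ h₂
    ext <;> simp only [bmul, Prod.fst_add, Prod.snd_add, Prod.fst_sub, Prod.snd_sub,
      Prod.fst_neg, Prod.snd_neg]
    · linear_combination h₁
    · linear_combination h₂
  rw [hfactor, bmul_assoc, bmul_comm _ (binv _), bmul_binv_self hden, bmul_one]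

/-- bicomplex Weierstrass formula: if `ξ₁² + ξ₂² + ξ₃² = 0` and
`𝒩(ξ₂ − ξ₃ i₂) ≠ 0`, then with `H := (ξ₂ − ξ₃ i₂)⁻¹` and `G := −ξ₁·(ξ₂ − ξ₃ i₂)⁻¹`
one has `𝒩(H) ≠ 0` and `(ξ₁, ξ₂, ξ₃) = (1/(2H))·(−2G, 1 − G², (1 + G²) i₂)`,
i.e. `ξ₁ = −G/H`, `ξ₂ = (1 − G²)/(2H)`, `ξ₃ = (1 + G²) i₂/(2H)`. -/
theorem bicomplex_weierstrass (ξ₁ ξ₂ ξ₃ : ℂ × ℂ)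
    (hnull : bmul ξ₁ ξ₁ + bmul ξ₂ ξ₂ + bmul ξ₃ ξ₃ = 0)
    (hden : bN (ξ₂ - bmul ξ₃ ((0 : ℂ), (1 : ℂ))) ≠ 0)
    (H G : ℂ × ℂ)
    (hH : H = binv (ξ₂ - bmul ξ₃ ((0 : ℂ), (1 : ℂ))))
    (hG : G = - bmul ξ₁ (binv (ξ₂ - bmul ξ₃ ((0 : ℂ), (1 : ℂ))))) :
    bN H ≠ 0 ∧
    ξ₁ = bmul (-G) (binv H) ∧
    ξ₂ = bmul (((1 : ℂ), (0 : ℂ)) - bmul G G) (binv ((2 : ℂ) • H)) ∧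
    ξ₃ = bmul (bmul (((1 : ℂ), (0 : ℂ)) + bmul G G) ((0 : ℂ), (1 : ℂ)))
      (binv ((2 : ℂ) • H)) := by
  have hHN : bN H ≠ 0 := by
    rw [hH, bN_binv hden]
    exact inv_ne_zero hden
  have hinv : binv H = ξ₂ - bmul ξ₃ (0, 1) := by rw [hH, binv_binv hden]
  have hone : bmul H (ξ₂ - bmul ξ₃ (0, 1)) = (1, 0) := by rw [hH, bmul_binv_self hden]
  have hsq : bmul (bmul G G) (ξ₂ - bmul ξ₃ (0, 1)) = -(ξ₂ + bmul ξ₃ (0, 1)) := by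
    have hGG : bmul G G = bmul (bmul (bmul ξ₁ ξ₁) H) H := by
      rw [hG, ← hH]
      ext <;> simp only [bmul, Prod.fst_neg, Prod.snd_neg] <;> ring
    rw [hGG, bmul_assoc, hone, bmul_one, hH, bmul_sq_binv_eq hnull hden]
  have hsq₁ := congrArg Prod.fst hsq
  have hsq₂ := congrArg Prod.snd hsq
  refine ⟨hHN, ?_, ?_, ?_⟩
  · rw [hinv, hG, neg_neg, ← hH, bmul_assoc, hone, bmul_one]
  all_goals
    rw [binv_smul, hinv]
    simp only [bmul, Prod.fst_add, Prod.snd_add, Prod.fst_sub, Prod.snd_sub,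
      Prod.fst_neg, Prod.snd_neg] at hsq₁ hsq₂
    ext <;> simp only [bmul, Prod.fst_add, Prod.snd_add, Prod.fst_sub, Prod.snd_sub,
      Prod.smul_fst, Prod.smul_snd, smul_eq_mul]
  · linear_combination (1 / 2) * hsq₁
  · linear_combination (1 / 2) * hsq₂
  · linear_combination (1 / 2) * hsq₂
  · linear_combination (-1 / 2) * hsq₁
end
end

section
/- Let 𝔻 be the hyperbolic numbers and ι_𝔻 : 𝔻 → 𝔹 the embedding ι_𝔻(x + yj) = (x, yi) ∈ ℂ² = 𝔹 (x, y ∈ ℝ). Then: (1) every real-analytic H-holomorphic map f : U → 𝔻 on an open set U ⊆ 𝔻 extends to a bicomplex-holomorphic map ψ : Ũ → 𝔹 on an open set Ũ ⊆ ℂ² containing ι_𝔻(U), with ψ(ι_𝔻(p)) = ι_𝔻(f(p)) for all p ∈ U; (2) the germ of the extension along ι_𝔻(U) is unique: any two such extensions agree on some open set containing ι_𝔻(U); (3) conversely, if ψ : Ũ → 𝔹 is bicomplex-holomorphic on an open Ũ ⊆ ℂ² and U := {x + yj ∈ 𝔻 : (x, yi) ∈ Ũ} is nonempty, then the restriction F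 : U → 𝔹, F(x + yj) := ψ(x, yi), is real-analytic and H-holomorphic in the sense that ∂F/∂y = j·∂F/∂x on U, where j := i₁i₂ = (0, i) ∈ 𝔹. -/
noncomputable section

/-- The embedding `ι_𝔻 : 𝔻 → 𝔹`, `x + y j ↦ (x, y i)`. -/
def iotaD (p : ℝ × ℝ) : ℂ × ℂ := ((p.1 : ℂ), (p.2 : ℂ) * Complex.I)

/-- H-holomorphic map on an open subset of the hyperbolic numbers `𝔻 = ℝ²`:
differentiable with components satisfying the H-Cauchy–Riemann equations. -/
def HHoloOn (f : ℝ × ℝ → ℝ × ℝ) (U : Set (ℝ × ℝ)) : Prop :=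
  DifferentiableOn ℝ f U ∧ ∀ p ∈ U,
    fderiv ℝ (fun q => (f q).1) p ((1 : ℝ), (0 : ℝ)) =
      fderiv ℝ (fun q => (f q).2) p ((0 : ℝ), (1 : ℝ)) ∧
    fderiv ℝ (fun q => (f q).1) p ((0 : ℝ), (1 : ℝ)) =
      fderiv ℝ (fun q => (f q).2) p ((1 : ℝ), (0 : ℝ))

/-- Bicomplex-holomorphic map on an open subset of `𝔹 = ℂ²`:
holomorphic components satisfying the bicomplex Cauchy–Riemann equations. -/
def BicomplexHoloOn (ψ : ℂ × ℂ → ℂ × ℂ) (U : Set (ℂ × ℂ)) : Prop :=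
  DifferentiableOn ℂ (fun q => (ψ q).1) U ∧ DifferentiableOn ℂ (fun q => (ψ q).2) U ∧
  ∀ p ∈ U,
    fderiv ℂ (fun q => (ψ q).1) p ((1 : ℂ), (0 : ℂ)) =
      fderiv ℂ (fun q => (ψ q).2) p ((0 : ℂ), (1 : ℂ)) ∧
    fderiv ℂ (fun q => (ψ q).1) p ((0 : ℂ), (1 : ℂ)) =
      - fderiv ℂ (fun q => (ψ q).2) p ((1 : ℂ), (0 : ℂ))

open Filter Topology Metric Set

section Transport

variable {𝕜 : Type*} [RCLike 𝕜]

/-- A function on `𝕜 × 𝕜` whose derivative along `(1, -κ⁻¹)` vanishes near `p` depends, near `p`,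
only on `q.1 + κ * q.2`. -/
lemma eventually_eq_comp_of_fderiv_apply_eq_zero {κ : 𝕜} (hκ : κ ≠ 0) {F : 𝕜 × 𝕜 → 𝕜} {p : 𝕜 × 𝕜}
    (hF : ∀ᶠ q in 𝓝 p, DifferentiableAt 𝕜 F q ∧ fderiv 𝕜 F q (1, -κ⁻¹) = 0) :
    ∀ᶠ q in 𝓝 p, F q =
      F (p + (((q.1 + κ * q.2) - (p.1 + κ * p.2)) / 2) • ((1 : 𝕜), κ⁻¹)) := by
  obtain ⟨r, hr, hF⟩ := eventually_nhds_iff_ball.1 hF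
  have hproj : Continuous fun q : 𝕜 × 𝕜 =>
      p + (((q.1 + κ * q.2) - (p.1 + κ * p.2)) / 2) • ((1 : 𝕜), κ⁻¹) := by fun_prop
  have hball : ∀ᶠ q in 𝓝 p,
      p + (((q.1 + κ * q.2) - (p.1 + κ * p.2)) / 2) • ((1 : 𝕜), κ⁻¹) ∈ ball p r :=
    hproj.continuousAt.eventually_mem (by simpa using ball_mem_nhds p hr)
  filter_upwards [hball, ball_mem_nhds p hr] with q hq hqr
  set q' := p + (((q.1 + κ * q.2) - (p.1 + κ * p.2)) / 2) • ((1 : 𝕜), κ⁻¹) with hq'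
  set v : 𝕜 × 𝕜 := (1, -κ⁻¹)
  set c : 𝕜 := ((q.1 - κ * q.2) - (p.1 - κ * p.2)) / 2 with hc
  have hqq : q = q' + c • v := by
    ext
    · simp [hq', hc, v]; ring
    · simp [hq', hc, v]; field_simp; ring
  let L : 𝕜 → 𝕜 × 𝕜 := fun t => q' + t • v
  have hL : ∀ t, HasDerivAt L v t := fun t => by
    simpa [L] using ((hasDerivAt_id t).smul_const v).const_add q'
  have hLc : Continuous L := by fun_prop
  have hconv : Convex ℝ (L ⁻¹' ball p r) := by
    intro s hs t ht a b ha hb hab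
    have := convex_ball p r hs ht ha hb hab
    have e : L (a • s + b • t) = a • L s + b • L t := by
      have h : a • q' + b • q' = q' := by rw [← add_smul, hab, one_smul]
      simp only [L, smul_add, add_smul, smul_assoc]
      nth_rw 1 [← h]
      abel
    rwa [mem_preimage, e]
  have hd : ∀ t ∈ L ⁻¹' ball p r, HasDerivAt (F ∘ L) 0 t := fun t ht => by
    have := (hF _ ht).1.hasFDerivAt.comp_hasDerivAt t (hL t)
    rwa [(hF _ ht).2] at this
  have := (isOpen_ball.preimage hLc).is_const_of_deriv_eq_zero hconv.isPreconnected
    (fun t ht => (hd t ht).differentiableAt.differentiableWithinAt) (fun t ht => (hd t ht).deriv)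
    (x := c) (y := 0) (by simpa [L, ← hqq] using hqr) (by simpa [L] using hq)
  simpa [L, ← hqq] using this

end Transport

/-- A real-analytic function of one variable extends to a complex-analytic one near each point. -/
lemma AnalyticAt.exists_complex_extension {g : ℝ → ℝ} (hg : AnalyticAt ℝ g 0) :
    ∃ G : ℂ → ℂ, AnalyticAt ℂ G 0 ∧ ∀ᶠ t : ℝ in 𝓝 0, G t = g t := by
  obtain ⟨p, hp⟩ := hg
  set P : FormalMultilinearSeries ℂ ℂ ℂ :=
    FormalMultilinearSeries.ofScalars ℂ fun n => (p.coeff n : ℂ)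
  have hrad : p.radius ≤ P.radius := by
    refine ENNReal.le_of_forall_nnreal_lt fun r hr => P.le_radius_of_summable_norm ?_
    refine (p.summable_norm_mul_pow hr).congr fun n => ?_
    rw [FormalMultilinearSeries.ofScalars_norm, p.norm_apply_eq_norm_coef, Complex.norm_real]
  refine ⟨P.sum, (P.hasFPowerSeriesOnBall (hp.radius_pos.trans_le hrad)).analyticAt, ?_⟩
  filter_upwards [hasFPowerSeriesAt_iff.1 hp] with t ht
  have h2 := Complex.hasSum_ofReal.2 ht
  rw [zero_add] at h2
  rw [← h2.tsum_eq]
  refine tsum_congr fun n => ?_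
  simp [P, mul_comm]

/-- A holomorphic function on a product of connected open sets vanishes if it vanishes on the
trace of `iotaD`. -/
lemma eq_zero_of_eq_zero_on_iotaD {V₁ V₂ : Set ℂ} (h₁ : IsOpen V₁) (h₂ : IsOpen V₂)
    (c₁ : IsPreconnected V₁) (c₂ : IsPreconnected V₂) {D : ℂ × ℂ → ℂ}
    (hD : DifferentiableOn ℂ D (V₁ ×ˢ V₂)) {p : ℝ × ℝ} (hp : iotaD p ∈ V₁ ×ˢ V₂)
    (h0 : ∀ w, iotaD w ∈ V₁ ×ˢ V₂ → D (iotaD w) = 0) : ∀ q ∈ V₁ ×ˢ V₂, D q = 0 := by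
  have key₁ : ∀ y : ℝ, (y : ℂ) * Complex.I ∈ V₂ → ∀ z ∈ V₁, D (z, y * Complex.I) = 0 := by
    intro y hy
    have ha : AnalyticOnNhd ℂ (fun z => D (z, y * Complex.I)) V₁ :=
      (hD.comp (t := V₁ ×ˢ V₂) (f := fun z : ℂ => (z, (y : ℂ) * Complex.I)) (by fun_prop)
        fun z hz => ⟨hz, hy⟩).analyticOnNhd h₁
    refine ha.eqOn_zero_of_preconnected_of_frequently_eq_zero c₁ hp.1 ?_
    have hlim : Tendsto (fun x : ℝ => (x : ℂ)) (𝓝[≠] p.1) (𝓝[≠] (p.1 : ℂ)) :=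
      Complex.continuous_ofReal.continuousWithinAt.tendsto_nhdsWithin fun x hx => by
        simpa using hx
    refine hlim.frequently (Eventually.frequently ?_)
    have : ∀ᶠ x : ℝ in 𝓝 p.1, (x : ℂ) ∈ V₁ :=
      Complex.continuous_ofReal.continuousAt.eventually_mem (h₁.mem_nhds hp.1)
    filter_upwards [this.filter_mono nhdsWithin_le_nhds] with x hx
    exact h0 (x, y) ⟨hx, hy⟩
  rintro ⟨z, w⟩ ⟨hz, hw⟩
  have ha : AnalyticOnNhd ℂ (fun w => D (z, w)) V₂ :=
    (hD.comp (t := V₁ ×ˢ V₂) (f := fun w : ℂ => (z, w)) (by fun_prop)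
      fun w hw => ⟨hz, hw⟩).analyticOnNhd h₂
  refine ha.eqOn_zero_of_preconnected_of_frequently_eq_zero c₂ hp.2 ?_ hw
  have hc : Continuous fun y : ℝ => (y : ℂ) * Complex.I := by fun_prop
  have hlim : Tendsto (fun y : ℝ => (y : ℂ) * Complex.I) (𝓝[≠] p.2)
      (𝓝[≠] ((p.2 : ℂ) * Complex.I)) :=
    hc.continuousWithinAt.tendsto_nhdsWithin fun y hy => by simpa using hy
  refine hlim.frequently (Eventually.frequently ?_)
  have : ∀ᶠ y : ℝ in 𝓝 p.2, (y : ℂ) * Complex.I ∈ V₂ :=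
    hc.continuousAt.eventually_mem (h₂.mem_nhds hp.2)
  filter_upwards [this.filter_mono nhdsWithin_le_nhds] with y hy
  exact key₁ y hy z hz

lemma isometry_iotaD : Isometry iotaD := by
  refine Isometry.of_dist_eq fun p q => ?_
  simp only [iotaD, Prod.dist_eq, Complex.dist_eq, ← sub_mul, ← Complex.ofReal_sub, norm_mul,
    Complex.norm_real, Complex.norm_I, mul_one, Real.dist_eq, Real.norm_eq_abs]

/-- The embedding `iotaD` as a continuous real-linear map. -/
def iotaDL : ℝ × ℝ →L[ℝ] ℂ × ℂ where
  toFun := iotaD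
  map_add' p q := by simp [iotaD, add_mul]
  map_smul' c p := by simp [iotaD, mul_assoc]
  cont := isometry_iotaD.continuous

/-- Two bicomplex-holomorphic maps which agree on the trace of `iotaD` in an intersection of
two balls centred on the slice agree on that intersection. -/
lemma BicomplexHoloOn.eqOn_ball_inter_ball {ψ₁ ψ₂ : ℂ × ℂ → ℂ × ℂ} {p₁ p₂ : ℝ × ℝ} {r₁ r₂ : ℝ}
    (h₁ : BicomplexHoloOn ψ₁ (ball (iotaD p₁) r₁)) (h₂ : BicomplexHoloOn ψ₂ (ball (iotaD p₂) r₂))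
    (h : ∀ w ∈ ball p₁ r₁ ∩ ball p₂ r₂, ψ₁ (iotaD w) = ψ₂ (iotaD w)) :
    EqOn ψ₁ ψ₂ (ball (iotaD p₁) r₁ ∩ ball (iotaD p₂) r₂) := by
  intro q hq
  have hmem : ∀ w, iotaD w ∈ ball (iotaD p₁) r₁ ∩ ball (iotaD p₂) r₂ ↔
      w ∈ ball p₁ r₁ ∩ ball p₂ r₂ := fun w => by
    simp only [mem_inter_iff, mem_ball, isometry_iotaD.dist_eq]
  have hw : (q.1.re, q.2.im) ∈ ball p₁ r₁ ∩ ball p₂ r₂ := by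
    have hd : ∀ p : ℝ × ℝ, dist (q.1.re, q.2.im) p ≤ dist q (iotaD p) := fun p => by
      rw [Prod.dist_eq, Prod.dist_eq]
      refine max_le_max ?_ ?_
      · simpa [iotaD, Complex.dist_eq, Real.dist_eq] using Complex.abs_re_le_norm (q.1 - p.1)
      · simpa [iotaD, Complex.dist_eq, Real.dist_eq] using
          Complex.abs_im_le_norm (q.2 - p.2 * Complex.I)
    exact ⟨(hd _).trans_lt hq.1, (hd _).trans_lt hq.2⟩
  have hprod : ball (iotaD p₁) r₁ ∩ ball (iotaD p₂) r₂ =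
      (ball (iotaD p₁).1 r₁ ∩ ball (iotaD p₂).1 r₂) ×ˢ
        (ball (iotaD p₁).2 r₁ ∩ ball (iotaD p₂).2 r₂) := by
    rw [← prod_inter_prod, ball_prod_same, ball_prod_same]
  have main : ∀ D : ℂ × ℂ → ℂ,
      DifferentiableOn ℂ D (ball (iotaD p₁) r₁ ∩ ball (iotaD p₂) r₂) →
      (∀ w ∈ ball p₁ r₁ ∩ ball p₂ r₂, D (iotaD w) = 0) → D q = 0 := by
    intro D hD h0
    rw [← hmem] at hw
    simp only [← hmem] at h0
    rw [hprod] at hD hq hw h0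
    exact eq_zero_of_eq_zero_on_iotaD (isOpen_ball.inter isOpen_ball)
      (isOpen_ball.inter isOpen_ball) ((convex_ball _ _).inter (convex_ball _ _)).isPreconnected
      ((convex_ball _ _).inter (convex_ball _ _)).isPreconnected hD hw h0 q hq
  ext1
  · exact sub_eq_zero.1 <| main (fun q => (ψ₁ q).1 - (ψ₂ q).1)
      ((h₁.1.mono inter_subset_left).sub (h₂.1.mono inter_subset_right))
      fun w hw => by simp [h w hw]
  · exact sub_eq_zero.1 <| main (fun q => (ψ₁ q).2 - (ψ₂ q).2)
      ((h₁.2.1.mono inter_subset_left).sub (h₂.2.1.mono inter_subset_right))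
      fun w hw => by simp [h w hw]

lemma BicomplexHoloOn.mono {ψ : ℂ × ℂ → ℂ × ℂ} {V W : Set (ℂ × ℂ)} (h : BicomplexHoloOn ψ W)
    (hVW : V ⊆ W) : BicomplexHoloOn ψ V :=
  ⟨h.1.mono hVW, h.2.1.mono hVW, fun p hp => h.2.2 p (hVW hp)⟩

/-- For `κ ^ 2 = -1`, the combination `ψ₁ + κ ψ₂` of the components of a bicomplex-holomorphic map
is complex-analytic. -/
lemma BicomplexHoloOn.analyticAt_add_mul {ψ : ℂ × ℂ → ℂ × ℂ} {V : Set (ℂ × ℂ)} (hV : IsOpen V)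
    (h : BicomplexHoloOn ψ V) {κ : ℂ} (hκ : κ * κ = -1) {p : ℂ × ℂ} (hp : p ∈ V) :
    AnalyticAt ℂ (fun q => (ψ q).1 + κ * (ψ q).2) p := by
  have hκ0 : κ ≠ 0 := by rintro rfl; simp at hκ
  have hinv : -κ⁻¹ = κ := by field_simp; rw [pow_two, hκ]
  have hdiff : ∀ q ∈ V, DifferentiableAt ℂ (fun q => (ψ q).1 + κ * (ψ q).2) q ∧
      fderiv ℂ (fun q => (ψ q).1 + κ * (ψ q).2) q (1, -κ⁻¹) = 0 := by
    intro q hq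
    have d₁ := (h.1 q hq).differentiableAt (hV.mem_nhds hq)
    have d₂ := (h.2.1 q hq).differentiableAt (hV.mem_nhds hq)
    refine ⟨d₁.add (d₂.const_mul κ), ?_⟩
    have hv : ((1 : ℂ), κ) = (1, 0) + κ • ((0 : ℂ), (1 : ℂ)) := by simp
    rw [fderiv_fun_add d₁ (d₂.const_mul κ), fderiv_const_mul d₂, hinv, hv]
    obtain ⟨e₁, e₂⟩ := h.2.2 q hq
    simp only [add_apply, smul_apply, map_add, map_smul,
      smul_eq_mul]
    linear_combination e₁ + κ * e₂ + fderiv ℂ (fun q => (ψ q).2) q (0, 1) * hκ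
  have hmem : ∀ᶠ q in 𝓝 p, q ∈ V := hV.mem_nhds hp
  have heq := eventually_eq_comp_of_fderiv_apply_eq_zero hκ0
    (hmem.mono fun q hq => hdiff q hq)
  let L : ℂ → ℂ × ℂ := fun z => p + (z / 2) • ((1 : ℂ), κ⁻¹)
  have hL : Differentiable ℂ L := by fun_prop
  have hG : AnalyticAt ℂ (fun z => (ψ (L z)).1 + κ * (ψ (L z)).2) 0 := by
    rw [Complex.analyticAt_iff_eventually_differentiableAt]
    have : ∀ᶠ z in 𝓝 (0 : ℂ), L z ∈ V :=
      hL.continuous.continuousAt.eventually_mem (hV.mem_nhds (by simpa [L, ← Prod.zero_eq_mk] using hp))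
    filter_upwards [this] with z hz
    exact (hdiff _ hz).1.comp z (hL z)
  refine AnalyticAt.congr ?_ (EventuallyEq.symm heq)
  refine AnalyticAt.fun_comp (g := fun z => (ψ (L z)).1 + κ * (ψ (L z)).2)
    (f := fun q : ℂ × ℂ => (q.1 + κ * q.2) - (p.1 + κ * p.2)) (by simpa using hG) ?_
  exact (analyticAt_fst.add (analyticAt_const.mul analyticAt_snd)).sub analyticAt_const

lemma BicomplexHoloOn.analyticAt {ψ : ℂ × ℂ → ℂ × ℂ} {V : Set (ℂ × ℂ)} (hV : IsOpen V)
    (h : BicomplexHoloOn ψ V) {p : ℂ × ℂ} (hp : p ∈ V) : AnalyticAt ℂ ψ p := by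
  have hA := h.analyticAt_add_mul hV (κ := -Complex.I) (by simp) hp
  have hB := h.analyticAt_add_mul hV (κ := Complex.I) (by simp) hp
  have h₁ : AnalyticAt ℂ (fun q => (ψ q).1) p := by
    refine ((hA.add hB).const_smul (c := (1 / 2 : ℂ))).congr (Eventually.of_forall fun q => ?_)
    simp; ring
  have h₂ : AnalyticAt ℂ (fun q => (ψ q).2) p := by
    refine ((hA.sub hB).const_smul (c := (Complex.I / 2 : ℂ))).congr
      (Eventually.of_forall fun q => ?_)
    simp only [Pi.smul_apply, Pi.sub_apply, smul_eq_mul]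
    linear_combination -(ψ q).2 * Complex.I_mul_I
  exact h₁.prod h₂

/-- If `s` is real-analytic near `p` with vanishing derivative along `(1, -κ⁻¹)`, then near `p` it
is the restriction of a complex-analytic function of `w.1 + κ * w.2`. -/
lemma exists_complex_extension_of_fderiv_apply_eq_zero {κ : ℝ} (hκ : κ ≠ 0) {s : ℝ × ℝ → ℝ}
    {p : ℝ × ℝ} (hs : AnalyticAt ℝ s p) (h0 : ∀ᶠ q in 𝓝 p, fderiv ℝ s q (1, -κ⁻¹) = 0) :
    ∃ G : ℂ → ℂ, AnalyticAt ℂ G 0 ∧ ∀ᶠ w : ℝ × ℝ in 𝓝 p,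
      G (((w.1 + κ * w.2 - (p.1 + κ * p.2) : ℝ) : ℂ)) = s w := by
  have hg : AnalyticAt ℝ (fun t : ℝ => s (p + (t / 2) • ((1 : ℝ), κ⁻¹))) 0 := by
    refine AnalyticAt.fun_comp (g := s) (by simpa using hs) ?_
    fun_prop
  obtain ⟨G, hG, hGs⟩ := hg.exists_complex_extension
  refine ⟨G, hG, ?_⟩
  have hc : Tendsto (fun w : ℝ × ℝ => w.1 + κ * w.2 - (p.1 + κ * p.2)) (𝓝 p) (𝓝 0) := by
    have : Continuous fun w : ℝ × ℝ => w.1 + κ * w.2 - (p.1 + κ * p.2) := by fun_prop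
    simpa using this.tendsto p
  have hd : ∀ᶠ q in 𝓝 p, DifferentiableAt ℝ s q :=
    hs.eventually_analyticAt.mono fun q hq => hq.differentiableAt
  filter_upwards [hc.eventually hGs,
    eventually_eq_comp_of_fderiv_apply_eq_zero hκ (hd.and h0)] with w hw hw'
  rw [hw, hw']

/-- A pair of holomorphic functions of the two idempotent coordinates `q.1 - I * q.2` and
`q.1 + I * q.2` gives a bicomplex-holomorphic map. -/
lemma bicomplexHoloOn_of_idempotent {A B : ℂ → ℂ} {a b : ℂ} {V : Set (ℂ × ℂ)}
    (hA : ∀ q ∈ V, DifferentiableAt ℂ A (q.1 - Complex.I * q.2 - a))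
    (hB : ∀ q ∈ V, DifferentiableAt ℂ B (q.1 + Complex.I * q.2 - b)) :
    BicomplexHoloOn (fun q =>
      ((A (q.1 - Complex.I * q.2 - a) + B (q.1 + Complex.I * q.2 - b)) / 2,
        Complex.I * (A (q.1 - Complex.I * q.2 - a) - B (q.1 + Complex.I * q.2 - b)) / 2)) V := by
  have hfst : ∀ q : ℂ × ℂ, HasFDerivAt (fun q : ℂ × ℂ => q.1) (ContinuousLinearMap.fst ℂ ℂ ℂ) q :=
    fun q => hasFDerivAt_fst
  have hsnd : ∀ q : ℂ × ℂ, HasFDerivAt (fun q : ℂ × ℂ => q.2) (ContinuousLinearMap.snd ℂ ℂ ℂ) q :=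
    fun q => hasFDerivAt_snd
  have dA := fun q (hq : q ∈ V) => (hA q hq).hasDerivAt.comp_hasFDerivAt q
    (((hfst q).sub ((hsnd q).const_mul Complex.I)).sub_const a)
  have dB := fun q (hq : q ∈ V) => (hB q hq).hasDerivAt.comp_hasFDerivAt q
    (((hfst q).add ((hsnd q).const_mul Complex.I)).sub_const b)
  have d₁ := fun q (hq : q ∈ V) => ((dA q hq).add (dB q hq)).mul_const (1 / 2 : ℂ)
  have d₂ := fun q (hq : q ∈ V) => ((dA q hq).sub (dB q hq)).mul_const (Complex.I / 2)
  have e₁ : (fun q : ℂ × ℂ =>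
      (A (q.1 - Complex.I * q.2 - a) + B (q.1 + Complex.I * q.2 - b)) / 2) =
      fun q : ℂ × ℂ =>
        (A (q.1 - Complex.I * q.2 - a) + B (q.1 + Complex.I * q.2 - b)) * (1 / 2) := by
    ext q; ring
  have e₂ : (fun q : ℂ × ℂ =>
      Complex.I * (A (q.1 - Complex.I * q.2 - a) - B (q.1 + Complex.I * q.2 - b)) / 2) =
      fun q : ℂ × ℂ =>
        (A (q.1 - Complex.I * q.2 - a) - B (q.1 + Complex.I * q.2 - b)) * (Complex.I / 2) := by
    ext q; ring
  unfold BicomplexHoloOn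
  simp only [e₁, e₂]
  refine ⟨fun q hq => (d₁ q hq).differentiableAt.differentiableWithinAt,
    fun q hq => (d₂ q hq).differentiableAt.differentiableWithinAt, fun q hq => ?_⟩
  have f₁ := (d₁ q hq).fderiv
  have f₂ := (d₂ q hq).fderiv
  simp only [Pi.add_apply, Pi.sub_apply, Function.comp_def] at f₁ f₂
  rw [f₁, f₂]
  constructor
  · simp; ring_nf; simp; ring
  · simp; ring_nf

/-- Local existence of the bicomplex-holomorphic extension. -/
lemma exists_local_extension {U : Set (ℝ × ℝ)} (hU : IsOpen U) {f : ℝ × ℝ → ℝ × ℝ}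
    (hfa : AnalyticOnNhd ℝ f U) (hfh : HHoloOn f U) {p : ℝ × ℝ} (hp : p ∈ U) :
    ∃ r > 0, ∃ ψ : ℂ × ℂ → ℂ × ℂ, BicomplexHoloOn ψ (ball (iotaD p) r) ∧
      ∀ w ∈ ball p r, ψ (iotaD w) = iotaD (f w) := by
  have hU' : ∀ᶠ q in 𝓝 p, q ∈ U := hU.mem_nhds hp
  have key : ∀ κ : ℝ, κ * κ = 1 → ∃ G : ℂ → ℂ, AnalyticAt ℂ G 0 ∧ ∀ᶠ w : ℝ × ℝ in 𝓝 p,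
      G (((w.1 + κ * w.2 - (p.1 + κ * p.2) : ℝ) : ℂ)) = ((f w).1 + κ * (f w).2 : ℝ) := by
    intro κ hκ
    have hκ0 : κ ≠ 0 := by rintro rfl; simp at hκ
    have hinv : κ⁻¹ = κ := by field_simp; rw [pow_two, hκ]
    have a₁ : ∀ q ∈ U, AnalyticAt ℝ (fun q => (f q).1) q :=
      fun q hq => analyticAt_fst.fun_comp (hfa q hq)
    have a₂ : ∀ q ∈ U, AnalyticAt ℝ (fun q => (f q).2) q :=
      fun q hq => analyticAt_snd.fun_comp (hfa q hq)
    have := exists_complex_extension_of_fderiv_apply_eq_zero hκ0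
      (s := fun q => (f q).1 + κ * (f q).2) ((a₁ p hp).add (analyticAt_const.mul (a₂ p hp)))
    simp only [Complex.ofReal_add, Complex.ofReal_mul] at this ⊢
    refine this ?_
    filter_upwards [hU'] with q hq
    have d₁ := (a₁ q hq).differentiableAt
    have d₂ := (a₂ q hq).differentiableAt
    have hv : ((1 : ℝ), -κ) = (1, 0) - κ • ((0 : ℝ), (1 : ℝ)) := by simp
    rw [fderiv_fun_add d₁ (d₂.const_mul κ), fderiv_const_mul d₂, hinv, hv]
    obtain ⟨e₁, e₂⟩ := hfh.2 q hq
    simp only [add_apply, smul_apply, map_sub, map_smul,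
      smul_eq_mul]
    linear_combination e₁ - κ * e₂ - fderiv ℝ (fun q => (f q).2) q (0, 1) * hκ
  obtain ⟨A, hA, hAf⟩ := key 1 (by norm_num)
  obtain ⟨B, hB, hBf⟩ := key (-1) (by norm_num)
  have ev : ∀ (G : ℂ → ℂ), AnalyticAt ℂ G 0 → ∀ ℓ : ℂ × ℂ → ℂ, Continuous ℓ → ℓ (iotaD p) = 0 →
      ∀ᶠ q in 𝓝 (iotaD p), DifferentiableAt ℂ G (ℓ q) := fun G hG ℓ hℓ h0 => by
    have := hℓ.tendsto (iotaD p)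
    rw [h0] at this
    exact this.eventually (hG.eventually_analyticAt.mono fun q hq => hq.differentiableAt)
  have evA := ev A hA (fun q => q.1 - Complex.I * q.2 - ((p.1 + p.2 : ℝ) : ℂ)) (by fun_prop) (by
    simp [iotaD]; linear_combination (-(p.2 : ℂ)) * Complex.I_mul_I)
  have evB := ev B hB (fun q => q.1 + Complex.I * q.2 - ((p.1 - p.2 : ℝ) : ℂ)) (by fun_prop) (by
    simp [iotaD]; linear_combination (p.2 : ℂ) * Complex.I_mul_I)
  obtain ⟨r₁, hr₁, h₁⟩ := eventually_nhds_iff_ball.1 (evA.and evB)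
  obtain ⟨r₂, hr₂, h₂⟩ := eventually_nhds_iff_ball.1 (hAf.and hBf)
  refine ⟨min r₁ r₂, lt_min hr₁ hr₂, _, bicomplexHoloOn_of_idempotent
    (fun q hq => (h₁ q (ball_subset_ball (min_le_left _ _) hq)).1)
    (fun q hq => (h₁ q (ball_subset_ball (min_le_left _ _) hq)).2), fun w hw => ?_⟩
  obtain ⟨hwA, hwB⟩ := h₂ w (ball_subset_ball (min_le_right _ _) hw)
  have eA : (iotaD w).1 - Complex.I * (iotaD w).2 - ((p.1 + p.2 : ℝ) : ℂ) =
      ((w.1 + 1 * w.2 - (p.1 + 1 * p.2) : ℝ) : ℂ) := by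
    simp [iotaD]; linear_combination (-(w.2 : ℂ)) * Complex.I_mul_I
  have eB : (iotaD w).1 + Complex.I * (iotaD w).2 - ((p.1 - p.2 : ℝ) : ℂ) =
      ((w.1 + (-1) * w.2 - (p.1 + (-1) * p.2) : ℝ) : ℂ) := by
    simp [iotaD]; linear_combination (w.2 : ℂ) * Complex.I_mul_I
  simp only [eA, eB, hwA, hwB]
  ext1
  · simp [iotaD]; ring
  · simp [iotaD]; ring

/-- real-analytic H-holomorphic maps on open subsets of the hyperbolic
numbers extend, germ-uniquely, to bicomplex-holomorphic maps; conversely restrictions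
of bicomplex-holomorphic maps to the slice `ι_𝔻(𝔻)` are real-analytic and
H-holomorphic in the sense `∂F/∂y = j·∂F/∂x` with `j = (0, i) ∈ 𝔹`. -/
theorem hholo_extends_bicomplex (U : Set (ℝ × ℝ)) (hU : IsOpen U)
    (f : ℝ × ℝ → ℝ × ℝ) (hfa : AnalyticOnNhd ℝ f U) (hfh : HHoloOn f U) :
    -- (1) existence of a bicomplex-holomorphic extension
    (∃ (Ut : Set (ℂ × ℂ)) (ψ : ℂ × ℂ → ℂ × ℂ), IsOpen Ut ∧ iotaD '' U ⊆ Ut ∧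
        BicomplexHoloOn ψ Ut ∧ ∀ p ∈ U, ψ (iotaD p) = iotaD (f p)) ∧
    -- (2) uniqueness of the germ of the extension along `ι_𝔻(U)`
    (∀ (Ut₁ Ut₂ : Set (ℂ × ℂ)) (ψ₁ ψ₂ : ℂ × ℂ → ℂ × ℂ),
        IsOpen Ut₁ → iotaD '' U ⊆ Ut₁ → BicomplexHoloOn ψ₁ Ut₁ →
        (∀ p ∈ U, ψ₁ (iotaD p) = iotaD (f p)) →
        IsOpen Ut₂ → iotaD '' U ⊆ Ut₂ → BicomplexHoloOn ψ₂ Ut₂ →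
        (∀ p ∈ U, ψ₂ (iotaD p) = iotaD (f p)) →
        ∃ W : Set (ℂ × ℂ), IsOpen W ∧ iotaD '' U ⊆ W ∧ W ⊆ Ut₁ ∩ Ut₂ ∧
          Set.EqOn ψ₁ ψ₂ W) ∧
    -- (3) restriction of a bicomplex-holomorphic map is real-analytic and
    -- H-holomorphic: `F(x + yj) := ψ(x, yi)` satisfies `∂F/∂y = j·∂F/∂x`
    (∀ (Ut : Set (ℂ × ℂ)) (ψ : ℂ × ℂ → ℂ × ℂ), IsOpen Ut → BicomplexHoloOn ψ Ut →
        {p : ℝ × ℝ | iotaD p ∈ Ut}.Nonempty →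
        ∀ p : ℝ × ℝ, iotaD p ∈ Ut →
          AnalyticAt ℝ (fun w : ℝ × ℝ => ψ (iotaD w)) p ∧
          fderiv ℝ (fun w : ℝ × ℝ => ψ (iotaD w)) p ((0 : ℝ), (1 : ℝ)) =
            bmul ((0 : ℂ), Complex.I)
              (fderiv ℝ (fun w : ℝ × ℝ => ψ (iotaD w)) p ((1 : ℝ), (0 : ℝ)))) := by
  refine ⟨?_, ?_, ?_⟩
  · choose! r hr Ψ hΨ hΨf using fun p (hp : p ∈ U) => exists_local_extension hU hfa hfh hp
    have hopen : IsOpen (⋃ p ∈ U, ball (iotaD p) (r p)) :=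
      isOpen_biUnion fun p _ => isOpen_ball
    have hex : ∀ q ∈ ⋃ p ∈ U, ball (iotaD p) (r p), ∃ p ∈ U, q ∈ ball (iotaD p) (r p) := by
      simp
    choose! c hcU hc using hex
    have hloc : ∀ p ∈ U, EqOn (fun q => Ψ (c q) q) (Ψ p) (ball (iotaD p) (r p)) := by
      intro p hp q hq
      have hq' : q ∈ ⋃ p ∈ U, ball (iotaD p) (r p) := mem_biUnion hp hq
      exact (hΨ _ (hcU q hq')).eqOn_ball_inter_ball (hΨ p hp)
        (fun w hw => (hΨf _ (hcU q hq') w hw.1).trans (hΨf p hp w hw.2).symm) ⟨hc q hq', hq⟩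
    refine ⟨_, fun q => Ψ (c q) q, hopen, ?_, ?_, ?_⟩
    · rintro _ ⟨p, hp, rfl⟩
      exact mem_biUnion hp (mem_ball_self (hr p hp))
    · have hev : ∀ q ∈ ⋃ p ∈ U, ball (iotaD p) (r p), ∃ p ∈ U, q ∈ ball (iotaD p) (r p) ∧
          (fun q => (Ψ (c q) q).1) =ᶠ[𝓝 q] (fun q => (Ψ p q).1) ∧
          (fun q => (Ψ (c q) q).2) =ᶠ[𝓝 q] (fun q => (Ψ p q).2) := by
        intro q hq
        refine ⟨c q, hcU q hq, hc q hq, ?_⟩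
        have : ∀ᶠ q' in 𝓝 q, Ψ (c q') q' = Ψ (c q) q' :=
          (hloc _ (hcU q hq)).eventuallyEq_of_mem (isOpen_ball.mem_nhds (hc q hq))
        exact ⟨this.mono fun _ h => congrArg Prod.fst h, this.mono fun _ h => congrArg Prod.snd h⟩
      refine ⟨fun q hq => ?_, fun q hq => ?_, fun q hq => ?_⟩
      · obtain ⟨p, hp, hqp, e₁, -⟩ := hev q hq
        exact (e₁.differentiableAt_iff.2
          (((hΨ p hp).1 q hqp).differentiableAt (isOpen_ball.mem_nhds hqp))).differentiableWithinAt
      · obtain ⟨p, hp, hqp, -, e₂⟩ := hev q hq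
        exact (e₂.differentiableAt_iff.2
          (((hΨ p hp).2.1 q hqp).differentiableAt
            (isOpen_ball.mem_nhds hqp))).differentiableWithinAt
      · obtain ⟨p, hp, hqp, e₁, e₂⟩ := hev q hq
        rw [e₁.fderiv_eq, e₂.fderiv_eq]
        exact (hΨ p hp).2.2 q hqp
    · intro p hp
      have := hloc p hp (mem_ball_self (hr p hp))
      exact this.trans (hΨf p hp p (mem_ball_self (hr p hp)))
  · intro Ut₁ Ut₂ ψ₁ ψ₂ ho₁ hs₁ hψ₁ hf₁ ho₂ hs₂ hψ₂ hf₂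
    have hball : ∀ p ∈ U, ∃ r > 0, ball (iotaD p) r ⊆ Ut₁ ∩ Ut₂ ∧ ball p r ⊆ U := by
      intro p hp
      obtain ⟨r₁, hr₁, h₁⟩ := Metric.isOpen_iff.1 (ho₁.inter ho₂) (iotaD p)
        ⟨hs₁ (mem_image_of_mem _ hp), hs₂ (mem_image_of_mem _ hp)⟩
      obtain ⟨r₂, hr₂, h₂⟩ := Metric.isOpen_iff.1 hU p hp
      exact ⟨min r₁ r₂, lt_min hr₁ hr₂, (ball_subset_ball (min_le_left _ _)).trans h₁,
        (ball_subset_ball (min_le_right _ _)).trans h₂⟩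
    choose! r hr hrU hrU' using hball
    refine ⟨⋃ p ∈ U, ball (iotaD p) (r p), isOpen_biUnion fun p _ => isOpen_ball, ?_,
      iUnion₂_subset hrU, ?_⟩
    · rintro _ ⟨p, hp, rfl⟩
      exact mem_biUnion hp (mem_ball_self (hr p hp))
    · intro q hq
      obtain ⟨p, hp, hqp⟩ := mem_iUnion₂.1 hq
      refine (hψ₁.mono ((hrU p hp).trans inter_subset_left)).eqOn_ball_inter_ball
        (hψ₂.mono ((hrU p hp).trans inter_subset_right)) (fun w hw => ?_) ⟨hqp, hqp⟩
      rw [hf₁ w (hrU' p hp hw.1), hf₂ w (hrU' p hp hw.1)]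
  · intro Ut ψ ho hψ _ p hp
    have ha := hψ.analyticAt ho hp
    refine ⟨(ha.restrictScalars (𝕜 := ℝ)).fun_comp (iotaDL.analyticAt p), ?_⟩
    have hd := ha.differentiableAt.hasFDerivAt
    have hcomp : HasFDerivAt (fun w : ℝ × ℝ => ψ (iotaD w))
        (((fderiv ℂ ψ (iotaD p)).restrictScalars ℝ).comp iotaDL) p :=
      (hd.restrictScalars ℝ).comp p iotaDL.hasFDerivAt
    rw [hcomp.fderiv]
    obtain ⟨e₁, e₂⟩ := hψ.2.2 (iotaD p) hp
    rw [hd.fst.fderiv, hd.snd.fderiv] at e₁ e₂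
    have i₀ : iotaDL (0, 1) = Complex.I • ((0 : ℂ), (1 : ℂ)) := by
      change iotaD (0, 1) = _
      simp [iotaD]
    have i₁ : iotaDL (1, 0) = ((1 : ℂ), (0 : ℂ)) := by
      change iotaD (1, 0) = _
      simp [iotaD]
    simp only [ContinuousLinearMap.comp_apply, ContinuousLinearMap.coe_restrictScalars', i₀, i₁,
      map_smul, bmul, ContinuousLinearMap.coe_fst', ContinuousLinearMap.coe_snd'] at e₁ e₂ ⊢
    ext1
    · simp [e₂]
    · simp [e₁]
end
end
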